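/- arXiv:1404.6202 — 2 statements merged into one kernel-verified Lean document; each statement's English description precedes it below -/
import Mathlib

section
/- Smooth local mixed Hessian inequality (Lemma 2.2 of the paper, flat metric): let Ω ⊆ ℂ^n be open and u_1,…,u_m : Ω → ℝ twice continuously differentiable functions whose complex Hessian matrices H(u_j)(z) satisfy σ_k(H(u_j)(z)) ≥ 0 for every k = 1,…,m, every j = 1,…,m and every z ∈ Ω (i.e. each u_j is m-subharmonic). Let f_1,…,f_m : Ω → ℝ be nonnegative functions with σ_m(H(u_j)(z)) ≥ f_j(z) for all z ∈ Ω and all j. Then for every z ∈ Ω, D_m(H(u_1)(z),…,H(u_m)(z))^m ≥ f_1(z) · f_2(z) ⋯ f_m(z). -/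
/-- `σ_k(A)`: the sum of all `k×k` principal minors of `A` (real part; for a Hermitian
matrix this sum is real and equals the `k`-th elementary symmetric polynomial of its
real eigenvalues).  `σ_0 = 1`. -/
noncomputable def sigmaMinor {n : ℕ} (k : ℕ) (A : Matrix (Fin n) (Fin n) ℂ) : ℝ :=
  (∑ S ∈ Finset.powersetCard k (Finset.univ : Finset (Fin n)),
    (A.submatrix (fun i : S => (i : Fin n)) (fun j : S => (j : Fin n))).det).re

/-- The polarized `m`-th Hessian form
`D_m(A₁,…,A_m) = (1/m!) ∑_{∅ ≠ T ⊆ {1,…,m}} (−1)^{m−|T|} σ_m(∑_{j∈T} A_j)`. -/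
noncomputable def Dpol {n m : ℕ} (A : Fin m → Matrix (Fin n) (Fin n) ℂ) : ℝ :=
  (m.factorial : ℝ)⁻¹ *
    ∑ T ∈ (Finset.univ : Finset (Finset (Fin m))).filter (fun T => T ≠ ∅),
      (-1 : ℝ) ^ (m - T.card) * sigmaMinor m (∑ j ∈ T, A j)

/-- The complex Hessian matrix `(∂²u/∂z_j∂z̄_k)(z)` of a twice (real-)differentiable
function `u` on `Ω ⊆ ℂⁿ`, expressed through the second real Fréchet derivative
`D²u(z) = iteratedFDerivWithin ℝ 2 u Ω z`. -/
noncomputable def complexHessian {n : ℕ} (u : (Fin n → ℂ) → ℝ) (Ω : Set (Fin n → ℂ))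
    (z : Fin n → ℂ) : Matrix (Fin n) (Fin n) ℂ := fun j k =>
  let D : (Fin n → ℂ) → (Fin n → ℂ) → ℝ :=
    fun a b => iteratedFDerivWithin ℝ 2 u Ω z ![a, b]
  let e : Fin n → (Fin n → ℂ) := fun i => Pi.single i 1
  (((D (e j) (e k) + D (Complex.I • e j) (Complex.I • e k)) / 4 : ℝ) : ℂ)
    + Complex.I * (((D (e j) (Complex.I • e k) - D (Complex.I • e j) (e k)) / 4 : ℝ) : ℂ)

/-- restriction of a multivariate polynomial to the line `x + t b` -/
noncomputable def linePoly {ι R A : Type*} [CommRing R] [CommRing A] [Algebra R A]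
    (P : MvPolynomial ι R) (x b : ι → A) : Polynomial A :=
  MvPolynomial.aeval (fun j => Polynomial.C (x j) + Polynomial.C (b j) * Polynomial.X) P

section line
variable {ι R A : Type*} [CommRing R] [CommRing A] [Algebra R A]

lemma linePoly_eval (P : MvPolynomial ι R) (x b : ι → A) (t : A) :
    (linePoly P x b).eval t = MvPolynomial.aeval (x + t • b) P := by
  unfold linePoly
  induction P using MvPolynomial.induction_on with
  | C a => simp [Polynomial.algebraMap_apply]
  | add p q hp hq => simp [hp, hq]
  | mul_X p i hp =>
    simp [hp]
    ring

lemma linePoly_coeff {m : ℕ} (P : MvPolynomial ι R) (hP : P.IsHomogeneous m) (x b : ι → A) :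
    (linePoly P x b).natDegree ≤ m ∧ (linePoly P x b).coeff m = MvPolynomial.aeval b P := by
  have key : ∀ d ∈ P.support,
      (MvPolynomial.aeval (fun j => Polynomial.C (x j) + Polynomial.C (b j) * Polynomial.X)
        (MvPolynomial.monomial d (P.coeff d))).natDegree ≤ m ∧
      (MvPolynomial.aeval (fun j => Polynomial.C (x j) + Polynomial.C (b j) * Polynomial.X)
        (MvPolynomial.monomial d (P.coeff d))).coeff m =
        MvPolynomial.aeval b (MvPolynomial.monomial d (P.coeff d)) := by
    intro d hd
    have hdeg : d.sum (fun _ k => k) = m := by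
      have := hP.degree_eq_sum_deg_support hd
      simpa [Finsupp.sum] using this.symm
    rw [MvPolynomial.aeval_monomial, MvPolynomial.aeval_monomial]
    subst hdeg
    generalize P.coeff d = c
    have hlin : ∀ j, (Polynomial.C (x j) + Polynomial.C (b j) * Polynomial.X).natDegree ≤ 1 := by
      intro j
      compute_degree
    have h2 : (d.prod fun i k =>
        (Polynomial.C (x i) + Polynomial.C (b i) * Polynomial.X) ^ k).natDegree ≤
          d.sum (fun _ k => k) ∧ (d.prod fun i k =>
        (Polynomial.C (x i) + Polynomial.C (b i) * Polynomial.X) ^ k).coeff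
          (d.sum (fun _ k => k)) = d.prod fun i k => b i ^ k := by
      unfold Finsupp.prod Finsupp.sum
      generalize d.support = s
      classical
      induction s using Finset.induction_on with
      | empty => simp
      | insert a s ha ih =>
        rw [Finset.prod_insert ha, Finset.prod_insert ha, Finset.sum_insert ha]
        have h1 : ((Polynomial.C (x a) + Polynomial.C (b a) * Polynomial.X) ^ d a).natDegree ≤ d a := by
          simpa using Polynomial.natDegree_pow_le_of_le (d a) (hlin a)
        refine ⟨Polynomial.natDegree_mul_le_of_le h1 ih.1, ?_⟩
        rw [Polynomial.coeff_mul_add_eq_of_natDegree_le h1 ih.1, ih.2]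
        congr 1
        have := Polynomial.coeff_pow_of_natDegree_le (m := d a) (hlin a)
        simpa using this
    rw [Polynomial.algebraMap_apply]
    refine ⟨(Polynomial.natDegree_C_mul_le _ _).trans h2.1, ?_⟩
    rw [Polynomial.coeff_C_mul, h2.2]
  unfold linePoly
  conv => 
    enter [1,1,1,2]
    rw [P.as_sum]
  conv => 
    enter [2]
    rw [P.as_sum]
  rw [map_sum, map_sum]
  refine ⟨Polynomial.natDegree_sum_le_of_forall_le _ _ fun d hd => (key d hd).1, ?_⟩
  rw [Polynomial.finsetSum_coeff]
  exact Finset.sum_congr rfl fun d hd => (key d hd).2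

lemma linePoly_derivative [DecidableEq ι] (P : MvPolynomial ι R) (x : ι → A) (a : ι) (t : A) :
    (Polynomial.derivative (linePoly P x (Pi.single a 1))).eval t =
      MvPolynomial.aeval (x + t • Pi.single a 1) (MvPolynomial.pderiv a P) := by
  unfold linePoly
  have ev : ∀ P : MvPolynomial ι R, (MvPolynomial.aeval (fun j => Polynomial.C (x j) +
     Polynomial.C ((Pi.single a 1 : ι → A) j) * Polynomial.X) P).eval t =
      MvPolynomial.aeval (x + t • Pi.single a 1) P := fun P => linePoly_eval P x _ t
  induction P using MvPolynomial.induction_on with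
  | C a => simp [Polynomial.algebraMap_apply]
  | add p q hp hq => simp [hp, hq]
  | mul_X p i hp =>
    simp only [map_mul, MvPolynomial.aeval_X, Polynomial.derivative_mul, Polynomial.eval_add,
      Polynomial.eval_mul, hp, ev, Derivation.leibniz, smul_eq_mul, map_add]
    by_cases h : i = a
    · subst h
      simp
      ring
    · simp [h, MvPolynomial.pderiv_X]
      try ring

lemma homog_smul {m : ℕ} (P : MvPolynomial ι R) (hP : P.IsHomogeneous m) (c : A) (x : ι → A) :
    MvPolynomial.aeval (c • x) P = c ^ m * MvPolynomial.aeval x P := by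
  conv => 
    enter [1]
    rw [P.as_sum]
  conv => 
    enter [2,2]
    rw [P.as_sum]
  rw [map_sum, map_sum, Finset.mul_sum]
  refine Finset.sum_congr rfl fun d hd => ?_
  have hdeg : d.sum (fun _ k => k) = m := by
      have := hP.degree_eq_sum_deg_support hd
      simpa [Finsupp.sum] using this.symm
  rw [MvPolynomial.aeval_monomial, MvPolynomial.aeval_monomial, ← hdeg]
  simp only [Pi.smul_apply, smul_eq_mul, mul_pow, Finsupp.prod, Finsupp.sum, Finset.prod_mul_distrib, Finset.prod_pow_eq_pow_sum]
  ring
end line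

lemma deriv_ne_zero_of_side (p : Polynomial ℂ) (hp : 0 < p.natDegree) (z : ℂ) (ε : ℝ)
    (h : ∀ r ∈ p.roots, 0 < ε * (z.im - r.im)) : p.derivative.eval z ≠ 0 := by
  have hp0 : p ≠ 0 := by rintro rfl; simp at hp
  have hz : p.eval z ≠ 0 := by
    intro h0
    have := h z ((Polynomial.mem_roots hp0).2 h0)
    simp at this
  rw [(IsAlgClosed.splits p).eval_derivative_eq_eval_mul_sum hz]
  refine mul_ne_zero hz fun hs => ?_
  have h1 : (p.roots.map fun r => -(ε * (1 / (z - r)).im)).sum = 0 := by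
    have := congrArg (fun w : ℂ => -(ε * w.im)) hs
    simp only [Complex.zero_im, mul_zero, neg_zero] at this
    rw [← this]
    generalize p.roots = s
    induction s using Multiset.induction_on with
    | empty => simp
    | cons a s ih => 
      simp only [Multiset.map_cons, Multiset.sum_cons, ih, Complex.add_im]
      ring
  have hpos : 0 < (p.roots.map fun r => -(ε * (1 / (z - r)).im)).sum := by
    have hne : p.roots ≠ 0 := (IsAlgClosed.splits p).roots_ne_zero hp.ne'
    obtain ⟨r, hr⟩ := Multiset.exists_mem_of_ne_zero hne
    have hall : ∀ r ∈ p.roots, 0 < -(ε * (1 / (z - r)).im) := by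
      intro r hr
      have h2 := h r hr
      have : (1 / (z - r)).im = - (z.im - r.im) / Complex.normSq (z - r) := by
        simp [Complex.inv_im]
      rw [this, show -(ε * (-(z.im - r.im) / Complex.normSq (z - r))) = ε * (z.im - r.im) / Complex.normSq (z - r) by ring]
      refine div_pos h2 (Complex.normSq_pos.2 fun h3 => ?_)
      rw [sub_eq_zero] at h3
      subst h3
      simp at h2
    obtain ⟨t, ht⟩ := Multiset.exists_cons_of_mem hr
    rw [ht, Multiset.map_cons, Multiset.sum_cons]
    refine add_pos_of_pos_of_nonneg (hall r hr) (Multiset.sum_nonneg ?_)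
    intro x hx
    obtain ⟨y, hy, rfl⟩ := Multiset.mem_map.1 hx
    exact (hall y (by rw [ht]; exact Multiset.mem_cons_of_mem hy)).le
  linarith

/-- AM-GM for multisets. -/
lemma multiset_amgm (s : Multiset ℝ) (hs : ∀ x ∈ s, 0 ≤ x) :
    s.prod * (s.card : ℝ) ^ s.card ≤ s.sum ^ s.card := by
  obtain ⟨l, rfl⟩ := Quot.exists_rep s
  have hl : (Quot.mk _ l : Multiset ℝ) = (l : Multiset ℝ) := rfl
  rw [hl] at hs ⊢
  simp only [Multiset.prod_coe, Multiset.coe_card, Multiset.sum_coe, Multiset.mem_coe] at *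
  rcases Nat.eq_zero_or_pos l.length with h0 | h0
  · have : l = [] := List.length_eq_zero_iff.1 h0
    subst this; simp
  have e1 : l.prod = ∏ i : Fin l.length, l[i] := by simp [Fin.prod_univ_getElem]
  have e2 : l.sum = ∑ i : Fin l.length, l[i] := by simp [Fin.sum_univ_getElem]
  rw [e1, e2]
  have hn : (0:ℝ) < l.length := by exact_mod_cast h0
  have hnn : ∀ i : Fin l.length, 0 ≤ l[i] := fun i => hs _ (by simp)
  have := Real.geom_mean_le_arith_mean Finset.univ (fun _ : Fin l.length => (1:ℝ)) (fun i => l[i])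
    (by simp) (by simpa using h0) (fun i _ => hnn i)
  simp only [Real.rpow_one, Finset.sum_const, Finset.card_univ, Fintype.card_fin, nsmul_eq_mul, mul_one, one_mul] at this
  have hP : 0 ≤ ∏ i : Fin l.length, l[i] := Finset.prod_nonneg fun i _ => hnn i
  have h3 := pow_le_pow_left₀ (Real.rpow_nonneg hP _) this l.length
  rw [Real.rpow_inv_natCast_pow hP h0.ne', div_pow, le_div_iff₀ (by positivity)] at h3
  exact h3

/-- the two-vector inequality in one variable -/
lemma real_rooted_ineq (r : Polynomial ℝ) (m : ℕ) (hm : 1 ≤ m) (hdeg : r.natDegree ≤ m)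
    (hlead : 0 < r.coeff m) (h0 : 0 < r.eval 0)
    (hreal : ∀ z : ℂ, 0 < z.im → (r.map (algebraMap ℝ ℂ)).eval z ≠ 0)
    (hpos : ∀ t : ℝ, 0 ≤ t → r.eval t ≠ 0) :
    0 < r.derivative.eval 0 ∧
      (r.eval 0) ^ (m - 1) * r.coeff m * (m : ℝ) ^ m ≤ (r.derivative.eval 0) ^ m := by
  have hd : r.natDegree = m := le_antisymm hdeg (Polynomial.le_natDegree_of_ne_zero hlead.ne')
  have hr0 : r ≠ 0 := by rintro rfl; simp at h0
  have hreal' : ∀ z : ℂ, (r.map (algebraMap ℝ ℂ)).eval z = 0 → z.im = 0 := by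
    intro z hz
    rcases lt_trichotomy z.im 0 with h | h | h
    · exfalso
      refine hreal ((starRingEnd ℂ) z) (by simpa using h) ?_
      have : (starRingEnd ℂ) ((r.map (algebraMap ℝ ℂ)).eval z) = 0 := by rw [hz]; simp
      rw [← this, Polynomial.eval_map_algebraMap, Polynomial.eval_map_algebraMap]
      exact Polynomial.aeval_conj r z
    · exact h
    · exact absurd hz (hreal z h)
  have hsplit : r.Splits := by
    have h1 : (r.map (algebraMap ℝ ℂ)).Splits := IsAlgClosed.splits _
    refine h1.of_splits_map_of_injective (algebraMap ℝ ℂ).injective ?_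
    intro a ha
    have ha' := (Polynomial.mem_roots (Polynomial.map_ne_zero hr0)).1 ha
    refine ⟨a.re, ?_⟩
    apply Complex.ext
    · simp
    · simp [hreal' a ha']
  have hroots : ∀ x ∈ r.roots, x < 0 := by
    intro x hx
    by_contra hc
    exact hpos x (not_lt.1 hc) ((Polynomial.mem_roots hr0).1 hx)
  have hcard : r.roots.card = m := by rw [← hsplit.natDegree_eq_card_roots, hd]
  have hder := hsplit.eval_derivative_eq_eval_mul_sum (x := 0) h0.ne'
  set s := r.roots.map fun z => 1 / (0 - z) with hs
  have hspos : ∀ x ∈ s, 0 < x := by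
    intro x hx
    obtain ⟨y, hy, rfl⟩ := Multiset.mem_map.1 hx
    have := hroots y hy
    apply one_div_pos.2; linarith
  have hsc : s.card = m := by rw [hs, Multiset.card_map, hcard]
  have hev : r.eval 0 * s.prod = r.coeff m := by
    rw [hsplit.eval_eq_prod_roots, mul_assoc, hs]
    have : (r.roots.map fun a => 0 - a).prod * (r.roots.map fun z => 1 / (0 - z)).prod = 1 := by
      rw [← Multiset.prod_map_mul]
      apply Multiset.prod_eq_one
      intro x hx
      obtain ⟨y, hy, rfl⟩ := Multiset.mem_map.1 hx
      have := hroots y hy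
      rw [mul_one_div_cancel]; linarith
    rw [this, Polynomial.leadingCoeff, hd, mul_one]
  have hsum : 0 < s.sum := by
    have : s ≠ 0 := by rintro h; rw [h] at hsc; simp at hsc; omega
    obtain ⟨x, hx⟩ := Multiset.exists_mem_of_ne_zero this
    obtain ⟨t, ht⟩ := Multiset.exists_cons_of_mem hx
    rw [ht, Multiset.sum_cons]
    refine add_pos_of_pos_of_nonneg (hspos x hx) (Multiset.sum_nonneg fun y hy => ?_)
    exact (hspos y (by rw [ht]; exact Multiset.mem_cons_of_mem hy)).le
  refine ⟨by rw [hder]; exact mul_pos h0 hsum, ?_⟩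
  have ham := multiset_amgm s fun x hx => (hspos x hx).le
  rw [hsc] at ham
  rw [hder, mul_pow, ← hev]
  obtain ⟨k, rfl⟩ : ∃ k, m = k + 1 := ⟨m - 1, by omega⟩
  calc _ = r.eval 0 ^ (k+1) * (s.prod * ((k+1 : ℕ):ℝ) ^ (k+1)) := by
        simp only [Nat.add_sub_cancel]; ring
    _ ≤ _ := by gcongr

/-- strong real stability -/
def StrongStable {ι : Type*} (P : MvPolynomial ι ℝ) : Prop :=
  ∀ z : ι → ℂ, (∀ i, 0 ≤ (z i).im) → (∃ i, 0 < (z i).im) → MvPolynomial.aeval z P ≠ 0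

lemma aeval_ofReal {ι : Type*} (P : MvPolynomial ι ℝ) (x : ι → ℝ) :
    MvPolynomial.aeval (fun i => (x i : ℂ)) P = ((MvPolynomial.aeval x P : ℝ) : ℂ) := by
  induction P using MvPolynomial.induction_on with
  | C a => simp
  | add p q hp hq => simp [hp, hq]
  | mul_X p i hp => simp [hp]

lemma strongStable_pderiv {ι : Type*} [DecidableEq ι] {m : ℕ} (hm : 1 ≤ m)
    (P : MvPolynomial ι ℝ) (hP : P.IsHomogeneous m) (hS : StrongStable P) (a : ι)
    (ha : MvPolynomial.aeval (Pi.single a (1 : ℝ)) P ≠ (0 : ℝ)) :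
    StrongStable (MvPolynomial.pderiv a P) := by
  intro z hz hz'
  have h := linePoly_derivative P z a 0
  rw [zero_smul, add_zero] at h
  rw [← h]
  have hc := linePoly_coeff P hP z (Pi.single a 1)
  have hca : (linePoly P z (Pi.single a 1)).coeff m ≠ 0 := by
    rw [hc.2]
    have e : (Pi.single a 1 : ι → ℂ) = fun i => (((Pi.single a 1 : ι → ℝ) i : ℝ) : ℂ) := by
      funext i
      by_cases h : i = a
      · subst h; simp
      · simp [h]
    rw [e, aeval_ofReal]
    exact_mod_cast ha
  refine deriv_ne_zero_of_side _ (lt_of_lt_of_le hm (Polynomial.le_natDegree_of_ne_zero hca)) 0 1 ?_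
  intro r hr
  have hr0 := (Polynomial.mem_roots'.1 hr).2
  rw [Polynomial.IsRoot, linePoly_eval] at hr0
  by_contra hcon
  have him : 0 ≤ r.im := by simp at hcon; exact hcon
  refine hS _ ?_ ?_ hr0
  · intro i
    by_cases h : i = a
    · subst h; simpa using add_nonneg (hz i) him
    · simpa [h] using hz i
  · obtain ⟨i, hi⟩ := hz'
    refine ⟨i, ?_⟩
    by_cases h : i = a
    · subst h; simpa using add_pos_of_pos_of_nonneg hi him
    · simpa [h] using hi

lemma linePoly_map {ι : Type*} (P : MvPolynomial ι ℝ) (x b : ι → ℝ) (z : ℂ) :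
    ((linePoly P x b).map (algebraMap ℝ ℂ)).eval z =
      MvPolynomial.aeval (fun i => (x i : ℂ) + z * (b i : ℂ)) P := by
  unfold linePoly
  induction P using MvPolynomial.induction_on with
  | C a => simp [Polynomial.algebraMap_apply]
  | add p q hp hq => rw [map_add, Polynomial.map_add, Polynomial.eval_add, hp, hq, map_add]
  | mul_X p i hp =>
    rw [map_mul, Polynomial.map_mul, Polynomial.eval_mul, hp, map_mul]
    simp
    left
    ring

lemma pair_ineq {ι : Type*} [DecidableEq ι] {m : ℕ} (hm : 1 ≤ m)
    (P : MvPolynomial ι ℝ) (hP : P.IsHomogeneous m) (hS : StrongStable P)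
    (hpos : ∀ j, 0 < MvPolynomial.aeval (Pi.single j (1 : ℝ)) P) (a i : ι) :
    0 < MvPolynomial.aeval (Pi.single i (1 : ℝ)) (MvPolynomial.pderiv a P) ∧
    (MvPolynomial.aeval (Pi.single i (1 : ℝ)) P) ^ (m - 1) *
      MvPolynomial.aeval (Pi.single a (1 : ℝ)) P * (m : ℝ) ^ m ≤
      (MvPolynomial.aeval (Pi.single i (1 : ℝ)) (MvPolynomial.pderiv a P)) ^ m := by
  have hc := linePoly_coeff P hP (Pi.single i (1 : ℝ)) (Pi.single a (1 : ℝ))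
  have hd := linePoly_derivative P (Pi.single i (1 : ℝ)) a 0
  have he := linePoly_eval P (Pi.single i (1 : ℝ)) (Pi.single a (1 : ℝ)) 0
  rw [zero_smul, add_zero] at hd he
  have key := real_rooted_ineq (linePoly P (Pi.single i (1 : ℝ)) (Pi.single a (1 : ℝ))) m hm hc.1
    (by rw [hc.2]; exact hpos a) (by rw [he]; exact hpos i) ?_ ?_
  · rw [hd, he, hc.2] at key
    exact key
  · intro z hz
    rw [linePoly_map]
    refine hS _ ?_ ⟨a, by simpa using hz⟩
    intro j
    by_cases h : j = a
    · subst h; simpa using hz.le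
    · simp [h]
  · intro t ht h0
    rw [linePoly_eval] at h0
    have h1 := homog_smul P hP Complex.I
      (fun j => (((Pi.single i (1 : ℝ) + t • Pi.single a (1 : ℝ) : ι → ℝ) j : ℝ) : ℂ))
    rw [aeval_ofReal, h0] at h1
    have hnn : ∀ j k : ι, 0 ≤ (Pi.single j (1 : ℝ) : ι → ℝ) k := by
      intro j k
      by_cases h : k = j
      · subst h; simp
      · simp [h]
    refine hS _ ?_ ?_ (h1.trans (by simp))
    · intro j
      simpa using add_nonneg (hnn i j) (mul_nonneg ht (hnn a j))
    · refine ⟨i, ?_⟩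
      simpa using add_pos_of_pos_of_nonneg one_pos (mul_nonneg ht (hnn a i))

/-- Garding inequality for strongly stable polynomials. -/
theorem garding {ι : Type*} [DecidableEq ι] (k : ℕ) :
    ∀ (P : MvPolynomial ι ℝ) (_ : P.IsHomogeneous (k + 1)) (_ : StrongStable P)
      (_ : ∀ j, 0 < MvPolynomial.aeval (Pi.single j (1 : ℝ)) P) (S : Finset ι) (_ : S.card = k + 1),
      0 < P.coeff (∑ i ∈ S, Finsupp.single i 1) ∧
      ∏ i ∈ S, MvPolynomial.aeval (Pi.single i (1 : ℝ)) P ≤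
        (P.coeff (∑ i ∈ S, Finsupp.single i 1) / ((k + 1).factorial : ℝ)) ^ (k + 1) := by
  induction k with
  | zero =>
    intro P hP hS hpos S hcard
    obtain ⟨a, rfl⟩ := Finset.card_eq_one.1 hcard
    have h := pair_ineq le_rfl P hP hS hpos a a
    have hq : (MvPolynomial.pderiv a P).IsHomogeneous 0 := hP.pderiv
    have hC := (MvPolynomial.totalDegree_eq_zero_iff_eq_C).1 (Nat.le_zero.1 hq.totalDegree_le)
    have hcf := MvPolynomial.coeff_pderiv (i := a) P 0
    rw [hC, hcf] at h
    simp at h ⊢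
    exact h
  | succ k ih =>
    intro P hP hS hpos S hcard
    obtain ⟨a, T, haT, rfl, hT⟩ := Finset.card_eq_succ.1 hcard
    have hq : (MvPolynomial.pderiv a P).IsHomogeneous (k + 1) := hP.pderiv
    have hpair := fun i => pair_ineq (by omega) P hP hS hpos a i
    obtain ⟨h1, h2⟩ := ih _ hq (strongStable_pderiv (by omega) P hP hS a (hpos a).ne')
      (fun j => (hpair j).1) T hT
    have hcf : (MvPolynomial.pderiv a P).coeff (∑ i ∈ T, Finsupp.single i 1) =
        P.coeff (∑ i ∈ insert a T, Finsupp.single i 1) := by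
      rw [MvPolynomial.coeff_pderiv, Finset.sum_insert haT, add_comm]
      have : (∑ i ∈ T, Finsupp.single i 1 : ι →₀ ℕ) a = 0 := by
        rw [Finsupp.finsetSum_apply]
        refine Finset.sum_eq_zero fun i hi => ?_
        rw [Finsupp.single_apply, if_neg]
        rintro rfl; exact haT hi
      rw [this]; simp
    rw [hcf] at h1 h2
    refine ⟨h1, ?_⟩
    set c := P.coeff (∑ i ∈ insert a T, Finsupp.single i 1)
    set p : ι → ℝ := fun i => MvPolynomial.aeval (Pi.single i (1 : ℝ)) P with hp
    set q : ι → ℝ := fun i => MvPolynomial.aeval (Pi.single i (1 : ℝ)) (MvPolynomial.pderiv a P) with hqd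
    have hp0 : ∀ i, 0 < p i := hpos
    have hq0 : ∀ i, 0 < q i := fun i => (hpair i).1
    have hpq : ∀ i, p i ^ (k + 1) * p a ≤ (q i / (k + 2 : ℝ)) ^ (k + 2) := by
      intro i
      have := (hpair i).2
      rw [div_pow, le_div_iff₀ (by positivity)]
      simp only [hp, hqd]
      simpa [add_assoc, one_add_one_eq_two] using this
    have h2' : ∏ i ∈ T, q i ≤ (c / ((k+1).factorial : ℝ)) ^ (k + 1) := h2
    have h3 : ∏ i ∈ T, (q i / (k + 2 : ℝ)) ≤ (c / ((k + 2).factorial : ℝ)) ^ (k + 1) := by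
      rw [Finset.prod_div_distrib, Finset.prod_const, hT, Nat.factorial_succ (k + 1)]
      have e : c / (((k + 1 + 1) * (k + 1).factorial : ℕ) : ℝ) = (c / ((k+1).factorial : ℝ)) / (k + 2 : ℝ) := by
        push_cast
        rw [div_div]; ring
      rw [e, div_pow _ (k + 2 : ℝ)]
      gcongr
    have h4 : (∏ i ∈ insert a T, p i) ^ (k + 1) ≤ ((c / ((k + 2).factorial : ℝ)) ^ (k + 2)) ^ (k + 1) := by
      calc (∏ i ∈ insert a T, p i) ^ (k + 1) = ∏ i ∈ T, (p i ^ (k + 1) * p a) := by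
            rw [Finset.prod_insert haT, Finset.prod_mul_distrib, Finset.prod_const, hT,
              Finset.prod_pow]
            ring
        _ ≤ ∏ i ∈ T, (q i / (k + 2 : ℝ)) ^ (k + 2) := by
            refine Finset.prod_le_prod (fun i _ => ?_) fun i _ => hpq i
            exact mul_nonneg (pow_nonneg (hp0 i).le _) (hp0 a).le
        _ = (∏ i ∈ T, (q i / (k + 2 : ℝ))) ^ (k + 2) := by rw [Finset.prod_pow]
        _ ≤ ((c / ((k + 2).factorial : ℝ)) ^ (k + 1)) ^ (k + 2) := by
            refine pow_le_pow_left₀ (Finset.prod_nonneg fun i _ => ?_) h3 _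
            exact div_nonneg (hq0 i).le (by positivity)
        _ = _ := by rw [← pow_mul, ← pow_mul, mul_comm]
    exact (pow_le_pow_iff_left₀ (Finset.prod_nonneg fun i _ => (hp0 i).le) (by positivity)
      (by omega : k + 1 ≠ 0)).1 h4

/-- root tracking along a path -/
lemma path_lemma {ι : Type*} [Finite ι] {m : ℕ} (P : MvPolynomial ι ℂ) (hP : P.IsHomogeneous m)
    (z : ℝ → ι → ℂ) (hz : Continuous z) (a : ι → ℂ) (ha : MvPolynomial.aeval a P ≠ 0)
    (hr : ∀ s ∈ Set.Icc (0 : ℝ) 1, ∀ t : ℝ, MvPolynomial.aeval (z s + (t : ℂ) • a) P ≠ 0)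
    (h0 : ∀ t : ℂ, 0 < t.im → MvPolynomial.aeval (z 0 + t • a) P ≠ 0) :
    ∀ t : ℂ, 0 < t.im → MvPolynomial.aeval (z 1 + t • a) P ≠ 0 := by
  have hcont : Continuous fun x : ι → ℂ => MvPolynomial.aeval x P := by
    simpa [MvPolynomial.aeval_eq_eval] using MvPolynomial.continuous_eval P
  let U : Set (Set.Icc (0:ℝ) 1) := {s | ∃ t : ℂ, 0 < t.im ∧ MvPolynomial.aeval (z s + t • a) P = 0}
  have hopen : IsOpen U := by
    rw [isOpen_iff_mem_nhds]
    rintro s0 ⟨t0, ht0, h⟩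
    have hc : Continuous fun s : Set.Icc (0:ℝ) 1 => ‖MvPolynomial.aeval (z s + t0 • a) P‖ := by
      fun_prop
    have hev : ∀ᶠ s : Set.Icc (0:ℝ) 1 in nhds s0, ‖MvPolynomial.aeval (z s + t0 • a) P‖ <
        ‖MvPolynomial.aeval a P‖ * t0.im ^ m := by
      apply hc.continuousAt.eventually_lt continuousAt_const
      rw [h, norm_zero]
      exact mul_pos (norm_pos_iff.2 ha) (pow_pos ht0 m)
    filter_upwards [hev] with s hs
    by_contra hcon
    have hcon' : ∀ t : ℂ, 0 < t.im → MvPolynomial.aeval (z s + t • a) P ≠ 0 := by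
      intro t ht h; exact hcon ⟨t, ht, h⟩
    have hc := linePoly_coeff P hP (z s) a
    set q := linePoly P (z s) a with hq
    have hd : q.natDegree = m := le_antisymm hc.1
      (Polynomial.le_natDegree_of_ne_zero (by rw [hc.2]; exact ha))
    have hqs : q.Splits := IsAlgClosed.splits q
    have hev := hqs.eval_eq_prod_roots (x := t0)
    rw [hq, linePoly_eval, ← hq] at hev
    rw [hev, norm_mul, Polynomial.leadingCoeff, hd, hc.2] at hs
    have hlt := lt_of_mul_lt_mul_left hs (norm_nonneg _)
    have hcard : q.roots.card = m := by rw [← hqs.natDegree_eq_card_roots, hd]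
    have hroots : ∀ r ∈ q.roots, r.im ≤ 0 := by
      intro r hr
      by_contra hc
      have := (Polynomial.mem_roots'.1 hr).2
      rw [Polynomial.IsRoot, hq, linePoly_eval] at this
      exact hcon' r (not_le.1 hc) this
    have hge : ∀ R : Multiset ℂ, (∀ r ∈ R, r.im ≤ 0) →
        t0.im ^ R.card ≤ ‖(R.map fun r => t0 - r).prod‖ := by
      intro R
      induction R using Multiset.induction_on with
      | empty => simp
      | cons r R ih =>
        intro hR
        rw [Multiset.map_cons, Multiset.prod_cons, norm_mul, Multiset.card_cons, pow_succ, mul_comm]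
        refine mul_le_mul ?_ (ih fun x hx => hR x (Multiset.mem_cons_of_mem hx)) (by positivity) (norm_nonneg _)
        have h1 := hR r (Multiset.mem_cons_self r R)
        calc t0.im ≤ (t0 - r).im := by simp; linarith
          _ ≤ |(t0 - r).im| := le_abs_self _
          _ ≤ _ := Complex.abs_im_le_norm _
    have := hge _ hroots
    rw [hcard] at this
    exact absurd hlt (not_lt.2 this)
  have hclosed : IsClosed U := by
    let K : Set (Set.Icc (0:ℝ) 1 × (ℂ × ℂ)) :=
      {x | x.2 ∈ Metric.sphere (0 : ℂ × ℂ) 1 ∧ 0 ≤ (x.2.2 * (starRingEnd ℂ) x.2.1).im ∧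
        MvPolynomial.aeval (x.2.1 • z x.1 + x.2.2 • a) P = 0}
    have hK : IsCompact K := by
      have h1 : IsCompact ((Set.univ : Set (Set.Icc (0:ℝ) 1)) ×ˢ Metric.sphere (0 : ℂ × ℂ) 1) :=
        isCompact_univ.prod (isCompact_sphere _ _)
      refine h1.of_isClosed_subset ?_ fun x hx => ⟨trivial, hx.1⟩
      have c2 : Continuous fun x : Set.Icc (0:ℝ) 1 × (ℂ × ℂ) => (x.2.2 * (starRingEnd ℂ) x.2.1).im :=
        Complex.continuous_im.comp (by fun_prop)
      have c3 : Continuous fun x : Set.Icc (0:ℝ) 1 × (ℂ × ℂ) =>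
          MvPolynomial.aeval (x.2.1 • z x.1 + x.2.2 • a) P := hcont.comp (by fun_prop)
      exact (Metric.isClosed_sphere.preimage continuous_snd).inter
        ((isClosed_le continuous_const c2).inter (isClosed_eq c3 continuous_const))
    have : U = Set.image Prod.fst K := by
      ext s
      constructor
      · rintro ⟨t, ht, h⟩
        have hn : (0:ℝ) < ‖((1 : ℂ), t)‖ := norm_pos_iff.2 (by simp)
        refine ⟨(s, ((‖((1 : ℂ), t)‖⁻¹ : ℝ) : ℂ) • ((1 : ℂ), t)), ⟨?_, ?_, ?_⟩, rfl⟩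
        · simp only [mem_sphere_zero_iff_norm, norm_smul, Complex.norm_real, norm_inv, norm_norm]
          exact inv_mul_cancel₀ hn.ne'
        · generalize ‖((1 : ℂ), t)‖⁻¹ = c
          simp
          have : c * t.im * c = c ^ 2 * t.im := by ring
          rw [this]
          positivity
        · generalize ((‖((1 : ℂ), t)‖⁻¹ : ℝ) : ℂ) = c
          have e : (c • ((1:ℂ), t)).1 • z s + (c • ((1:ℂ), t)).2 • a = c • (z s + t • a) := by
            simp [smul_smul]
          simp only [e]
          rw [homog_smul P hP, h, mul_zero]
      · rintro ⟨⟨s', τ, w⟩, ⟨h1, h2, h3⟩, rfl⟩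
        simp only at h1 h2 h3
        have hτ : τ ≠ 0 := by
          rintro rfl
          rw [zero_smul, zero_add, homog_smul P hP] at h3
          have hw : w ≠ 0 := by
            rintro rfl
            simp at h1
          exact mul_ne_zero (pow_ne_zero _ hw) ha h3
        have e : τ • z s' + w • a = τ • (z s' + (w / τ) • a) := by
          rw [smul_add, smul_smul, mul_div_cancel₀ _ hτ]
        rw [e, homog_smul P hP] at h3
        have h4 := (mul_eq_zero.1 h3).resolve_left (pow_ne_zero _ hτ)
        have him : (w / τ).im = (w * (starRingEnd ℂ) τ).im / Complex.normSq τ := by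
          rw [Complex.div_im, Complex.mul_im]
          simp
          ring
        have him0 : 0 ≤ (w / τ).im := by
          rw [him]; exact div_nonneg h2 (Complex.normSq_nonneg _)
        refine ⟨w / τ, lt_of_le_of_ne him0 fun h => ?_, h4⟩
        have : w / τ = (((w / τ).re : ℝ) : ℂ) := Complex.ext (by simp) (by simp [← h])
        rw [this] at h4
        exact hr s' s'.2 _ h4
    rw [this]
    exact (hK.image continuous_fst).isClosed
  have hU : U = ∅ ∨ U = Set.univ := isClopen_iff.1 ⟨hclosed, hopen⟩
  have hemp : U = ∅ := by
    refine hU.resolve_right fun h => ?_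
    have : (⟨0, by simp⟩ : Set.Icc (0:ℝ) 1) ∈ U := by rw [h]; trivial
    obtain ⟨t, ht, h⟩ := this
    exact h0 t ht h
  intro t ht h
  have : (⟨1, by simp⟩ : Set.Icc (0:ℝ) 1) ∈ U := ⟨t, ht, h⟩
  rw [hemp] at this
  exact this

section mat
variable {n : ℕ}

/-- complex valued sum of principal minors -/
noncomputable def sigC (k : ℕ) (A : Matrix (Fin n) (Fin n) ℂ) : ℂ :=
  ∑ S ∈ Finset.powersetCard k (Finset.univ : Finset (Fin n)),
    (A.submatrix (fun i : S => (i : Fin n)) (fun j : S => (j : Fin n))).det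

lemma sigmaMinor_eq (k : ℕ) (A : Matrix (Fin n) (Fin n) ℂ) : sigmaMinor k A = (sigC k A).re := rfl

/-- generic sum of minors as polynomial -/
noncomputable def sigPoly (n m : ℕ) : MvPolynomial (Fin n × Fin n) ℂ :=
  ∑ S ∈ Finset.powersetCard m (Finset.univ : Finset (Fin n)),
    ((Matrix.of fun i j => MvPolynomial.X (i, j) :
      Matrix (Fin n) (Fin n) (MvPolynomial (Fin n × Fin n) ℂ)).submatrix
        (fun i : S => (i : Fin n)) (fun j : S => (j : Fin n))).det

/-- matrix as vector -/
def mvec {R : Type*} (A : Matrix (Fin n) (Fin n) R) : Fin n × Fin n → R := fun p => A p.1 p.2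

lemma aeval_sigPoly (m : ℕ) (A : Matrix (Fin n) (Fin n) ℂ) :
    MvPolynomial.aeval (mvec A) (sigPoly n m) = sigC m A := by
  unfold sigPoly sigC
  rw [map_sum]
  refine Finset.sum_congr rfl fun S _ => ?_
  rw [AlgHom.map_det]
  congr 1
  ext i j
  simp [mvec]

lemma sigPoly_homog (m : ℕ) : (sigPoly n m).IsHomogeneous m := by
  unfold sigPoly
  refine MvPolynomial.IsHomogeneous.sum _ _ _ fun S hS => ?_
  rw [Matrix.det_apply]
  refine MvPolynomial.IsHomogeneous.sum _ _ _ fun σ _ => ?_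
  have hc : m = ∑ i : S, 1 := by
    simp [(Finset.mem_powersetCard.1 hS).2]
  have : (∏ i : S, ((Matrix.of fun i j => MvPolynomial.X (i, j) :
      Matrix (Fin n) (Fin n) (MvPolynomial (Fin n × Fin n) ℂ)).submatrix
        (fun i : S => (i : Fin n)) (fun j : S => (j : Fin n))) (σ i) i).IsHomogeneous m := by
    conv => 
      arg 2
      rw [hc]
    refine MvPolynomial.IsHomogeneous.prod _ _ _ fun i _ => ?_
    exact MvPolynomial.isHomogeneous_X _ _
  rcases Int.units_eq_one_or (Equiv.Perm.sign σ) with h | h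
  · rw [h, one_smul]; exact this
  · rw [h, Units.neg_smul, one_smul]; exact this.neg

/-- `det (A + t)` as a polynomial in `t` -/
noncomputable def chi (A : Matrix (Fin n) (Fin n) ℂ) : Polynomial ℂ := (-A).charpoly

lemma chi_coeff (A : Matrix (Fin n) (Fin n) ℂ) {k : ℕ} (hk : k ≤ n) :
    (chi A).coeff (n - k) = sigC k A := by
  have := Matrix.charpoly_coeff_eq_sum_minors (-A) k (by simpa using hk)
  rw [Fintype.card_fin] at this
  rw [chi, this, sigC, Finset.mul_sum]
  refine Finset.sum_congr rfl fun S hS => ?_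
  have h1 : (-A).submatrix (Subtype.val : S → Fin n) (Subtype.val : S → Fin n) =
    -(A.submatrix (Subtype.val : S → Fin n) (Subtype.val : S → Fin n)) := rfl
  rw [h1, Matrix.det_neg, Fintype.card_coe, (Finset.mem_powersetCard.1 hS).2, ← mul_assoc, ← mul_pow]
  simp

lemma chi_shift (A : Matrix (Fin n) (Fin n) ℂ) (s : ℂ) :
    chi (A + s • 1) = Polynomial.taylor s (chi A) := by
  apply Polynomial.funext
  intro t
  rw [Polynomial.taylor_eval, chi, chi, Matrix.eval_charpoly, Matrix.eval_charpoly]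
  congr 1
  ext i j
  simp only [Matrix.scalar_apply, Matrix.sub_apply, Matrix.neg_apply, Matrix.add_apply, Matrix.smul_apply,
    Matrix.one_apply, Matrix.diagonal_apply, smul_eq_mul]
  split_ifs <;> ring

lemma sig_shift (A : Matrix (Fin n) (Fin n) ℂ) (s : ℂ) {k : ℕ} (hk : k ≤ n) :
    sigC k (A + s • 1) = (Polynomial.hasseDeriv (n - k) (chi A)).eval s := by
  rw [← chi_coeff _ hk, chi_shift, Polynomial.taylor_coeff]

lemma chi_natDegree (A : Matrix (Fin n) (Fin n) ℂ) : (chi A).natDegree = n := by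
  rw [chi, Matrix.charpoly_natDegree_eq_dim, Fintype.card_fin]

lemma chi_root (A : Matrix (Fin n) (Fin n) ℂ) (hA : A.IsHermitian) (z : ℂ) (hz : z.im ≠ 0) :
    (chi A).eval z ≠ 0 := by
  rw [chi, hA.neg.charpoly_eq, Polynomial.eval_prod, Finset.prod_ne_zero_iff]
  intro i _ h
  simp [sub_eq_zero] at h
  rw [h] at hz
  simp at hz

lemma iter_deriv_root (p : Polynomial ℂ) (hp : ∀ z : ℂ, z.im ≠ 0 → p.eval z ≠ 0) :
    ∀ j ≤ p.natDegree, (Polynomial.derivative^[j] p).natDegree = p.natDegree - j ∧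
      ∀ z : ℂ, z.im ≠ 0 → (Polynomial.derivative^[j] p).eval z ≠ 0 := by
  intro j
  induction j with
  | zero => intro _; simpa using hp
  | succ j ih =>
    intro hj
    obtain ⟨h1, h2⟩ := ih (by omega)
    rw [Function.iterate_succ_apply']
    refine ⟨by rw [Polynomial.natDegree_derivative, h1]; omega, ?_⟩
    intro z hz
    refine deriv_ne_zero_of_side _ (by omega) z z.im ?_
    intro r hr
    have hr0 : r.im = 0 := by
      by_contra hc
      exact h2 r hc (Polynomial.mem_roots'.1 hr).2
    rw [hr0, sub_zero]
    exact mul_self_pos.2 hz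

lemma sig_hyp (A : Matrix (Fin n) (Fin n) ℂ) (hA : A.IsHermitian) {k : ℕ} (hk : k ≤ n) (s : ℂ)
    (hs : s.im ≠ 0) : sigC k (A + s • 1) ≠ 0 := by
  rw [sig_shift A s hk]
  have h := (iter_deriv_root (chi A) (chi_root A hA) (n - k) (by rw [chi_natDegree]; omega)).2 s hs
  rw [← Polynomial.factorial_smul_hasseDeriv] at h
  intro h0
  apply h
  simp [h0]

lemma sig_real (A : Matrix (Fin n) (Fin n) ℂ) (hA : A.IsHermitian) (k : ℕ) :
    sigC k A = (sigmaMinor k A : ℂ) := by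
  rw [sigmaMinor_eq]
  refine (Complex.conj_eq_iff_re.1 ?_).symm
  unfold sigC
  rw [map_sum]
  refine Finset.sum_congr rfl fun S _ => ?_
  have := Matrix.det_conjTranspose (M := A.submatrix (fun i : S => (i : Fin n)) (fun j : S => (j : Fin n)))
  rw [Matrix.conjTranspose_submatrix, hA.eq] at this
  exact this.symm

lemma sig_expand (A : Matrix (Fin n) (Fin n) ℂ) (s : ℂ) {k : ℕ} (hk : k ≤ n) :
    sigC k (A + s • 1) = ∑ i ∈ Finset.range (k + 1),
      ((i + (n - k)).choose (n - k) : ℂ) * sigC (k - i) A * s ^ i := by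
  rw [sig_shift A s hk, Polynomial.eval_eq_sum_range' (n := k + 1)]
  · refine Finset.sum_congr rfl fun i hi => ?_
    have hi' : i ≤ k := by simpa [Nat.lt_succ_iff] using hi
    rw [Polynomial.hasseDeriv_coeff, ← chi_coeff A (by omega : k - i ≤ n)]
    congr 3
    omega
  · have := Polynomial.natDegree_hasseDeriv_le (chi A) (n - k)
    rw [chi_natDegree] at this
    omega

lemma herm_shift (A : Matrix (Fin n) (Fin n) ℂ) (hA : A.IsHermitian) (s : ℝ) :
    (A + (s : ℂ) • 1).IsHermitian := by
  refine hA.add ?_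
  unfold Matrix.IsHermitian
  rw [Matrix.conjTranspose_smul]
  simp

lemma sig_pos (A : Matrix (Fin n) (Fin n) ℂ) (hA : A.IsHermitian) {m : ℕ}
    (hG : ∀ k, 1 ≤ k → k ≤ m → 0 ≤ sigmaMinor k A) (s : ℝ) (hs : 0 < s) {k : ℕ} (hkm : k ≤ m)
    (hk : k ≤ n) : 0 < sigmaMinor k (A + (s : ℂ) • 1) := by
  have h := sig_expand A s hk
  rw [sig_real _ (herm_shift A hA s)] at h
  have h' : sigmaMinor k (A + (s : ℂ) • 1) = ∑ i ∈ Finset.range (k + 1),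
      ((i + (n - k)).choose (n - k) : ℝ) * sigmaMinor (k - i) A * s ^ i := by
    have : ((∑ i ∈ Finset.range (k + 1),
      ((i + (n - k)).choose (n - k) : ℝ) * sigmaMinor (k - i) A * s ^ i : ℝ) : ℂ) = ∑ i ∈ Finset.range (k + 1),
      ((i + (n - k)).choose (n - k) : ℂ) * sigC (k - i) A * s ^ i := by
      push_cast
      exact Finset.sum_congr rfl fun i _ => by rw [sig_real A hA]
    rw [← this] at h
    exact_mod_cast h
  have h00 : sigmaMinor 0 A = 1 := by simp [sigmaMinor]
  rw [h', Finset.sum_range_succ]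
  refine add_pos_of_nonneg_of_pos (Finset.sum_nonneg fun i hi => ?_) ?_
  · have : i < k := by simpa using hi
    have := hG (k - i) (by omega) (by omega)
    positivity
  · rw [Nat.sub_self, h00, mul_one]
    have : 0 < (k + (n - k)).choose (n - k) := Nat.choose_pos (by omega)
    positivity

lemma cone1 {m : ℕ} (hmn : m ≤ n) (B : Matrix (Fin n) (Fin n) ℂ) (hB : B.IsHermitian)
    (hG : ∀ s : ℝ, 0 ≤ s → 0 < sigmaMinor m (B + (s : ℂ) • 1))
    (X : Matrix (Fin n) (Fin n) ℂ) (hX : X.IsHermitian) (α : ℝ) (hα : 0 < α) (t : ℂ) (ht : 0 < t.im) :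
    sigC m (X + (Complex.I * α) • 1 + t • B) ≠ 0 := by
  have hB0 : sigC m B ≠ 0 := by
    rw [sig_real B hB]
    have := hG 0 le_rfl
    simp at this
    exact_mod_cast this.ne'
  have key := path_lemma (sigPoly n m) (sigPoly_homog m)
    (fun s => mvec ((s : ℂ) • X + (Complex.I * α) • 1)) ?_ (mvec B) (by rwa [aeval_sigPoly]) ?_ ?_ t ht
  · have e : mvec (((1:ℝ) : ℂ) • X + (Complex.I * α) • 1) + t • mvec B =
      mvec (X + (Complex.I * α) • 1 + t • B) := by
      rw [Complex.ofReal_one, one_smul]; rfl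
    rw [e, aeval_sigPoly] at key
    exact key
  · unfold mvec
    simp only [Matrix.add_apply, Matrix.smul_apply]
    fun_prop
  · intro s _ r
    have e : mvec ((s : ℂ) • X + (Complex.I * α) • 1) + (r : ℂ) • mvec B =
      mvec (((s : ℂ) • X + (r : ℂ) • B) + (Complex.I * α) • 1) := by
      rw [add_right_comm]; rfl
    simp only [e, aeval_sigPoly]
    refine sig_hyp _ ?_ hmn _ (by simpa using hα.ne')
    refine Matrix.IsHermitian.add ?_ ?_
    · unfold Matrix.IsHermitian
      rw [Matrix.conjTranspose_smul, hX.eq]; simp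
    · unfold Matrix.IsHermitian
      rw [Matrix.conjTranspose_smul, hB.eq]; simp
  · intro t ht h
    have ht0 : t ≠ 0 := by rintro rfl; simp at ht
    have e : mvec (((0:ℝ) : ℂ) • X + (Complex.I * α) • 1) + t • mvec B =
      t • mvec (B + ((Complex.I * α) / t) • 1) := by
      funext p
      simp [mvec]
      field_simp
      ring
    simp only [e] at h
    rw [homog_smul _ (sigPoly_homog m), aeval_sigPoly] at h
    have h1 := (mul_eq_zero.1 h).resolve_left (pow_ne_zero _ ht0)
    set w := (Complex.I * α) / t with hw
    have hwim : w.im = 0 := by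
      by_contra hc
      exact sig_hyp B hB hmn w hc h1
    have hwr : w = ((w.re : ℝ) : ℂ) := Complex.ext (by simp) (by simp [hwim])
    have hre : 0 ≤ w.re := by
      have e2 : w.re = α * t.im / Complex.normSq t := by
        rw [hw, Complex.div_re]; simp
      rw [e2]
      exact div_nonneg (mul_nonneg hα.le ht.le) (Complex.normSq_nonneg t)
    rw [hwr, sig_real _ (herm_shift B hB _)] at h1
    have := hG w.re hre
    norm_cast at h1
    exact this.ne' h1

lemma real_smul_herm (A : Matrix (Fin n) (Fin n) ℂ) (hA : A.IsHermitian) (s : ℝ) :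
    ((s : ℂ) • A).IsHermitian := by
  unfold Matrix.IsHermitian
  rw [Matrix.conjTranspose_smul, hA.eq]; simp

lemma cone2 {m : ℕ} (hmn : m ≤ n) {ι : Type*} [DecidableEq ι] (B : ι → Matrix (Fin n) (Fin n) ℂ)
    (hB : ∀ j, (B j).IsHermitian)
    (hG : ∀ j, ∀ s : ℝ, 0 ≤ s → 0 < sigmaMinor m (B j + (s : ℂ) • 1)) (S : Finset ι) :
    ∀ (X : Matrix (Fin n) (Fin n) ℂ) (_ : X.IsHermitian) (α : ℝ) (_ : 0 < α) (y : ι → ℝ)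
      (_ : ∀ j, 0 ≤ y j),
    sigC m (X + (Complex.I * α) • 1 + Complex.I • ∑ j ∈ S, (y j : ℂ) • B j) ≠ 0 := by
  induction S using Finset.induction_on with
  | empty =>
    intro X hX α hα y hy
    simpa using sig_hyp X hX hmn (Complex.I * α) (by simpa using hα.ne')
  | insert a S ha ih =>
    intro X hX α hα y hy
    rcases (hy a).eq_or_lt with h0 | h0
    · rw [Finset.sum_insert ha, ← h0]
      simpa using ih X hX α hα y hy
    have hB0 : sigC m (B a) ≠ 0 := by
      rw [sig_real _ (hB a)]
      have := hG a 0 le_rfl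
      simp at this
      exact_mod_cast this.ne'
    have key := path_lemma (sigPoly n m) (sigPoly_homog m)
      (fun s => mvec (X + (Complex.I * α) • 1 + (s : ℂ) • (Complex.I • ∑ j ∈ S, (y j : ℂ) • B j))) ?_
      (mvec (B a)) (by rwa [aeval_sigPoly]) ?_ ?_ (Complex.I * y a) (by simpa using h0)
    · have e : mvec (X + (Complex.I * α) • 1 + ((1:ℝ) : ℂ) • (Complex.I • ∑ j ∈ S, (y j : ℂ) • B j)) +
          (Complex.I * y a) • mvec (B a) =
          mvec (X + (Complex.I * α) • 1 + Complex.I • ∑ j ∈ insert a S, (y j : ℂ) • B j) := by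
        rw [Complex.ofReal_one, one_smul, Finset.sum_insert ha, smul_add, smul_smul,
          add_comm ((Complex.I * y a) • B a), ← add_assoc]
        rfl
      rw [e, aeval_sigPoly] at key
      exact key
    · unfold mvec
      simp only [Matrix.add_apply, Matrix.smul_apply]
      fun_prop
    · intro s hs r
      have e : mvec (X + (Complex.I * α) • 1 + (s : ℂ) • (Complex.I • ∑ j ∈ S, (y j : ℂ) • B j)) +
          (r : ℂ) • mvec (B a) =
          mvec ((X + (r : ℂ) • B a) + (Complex.I * α) • 1 +
            Complex.I • ∑ j ∈ S, ((s * y j : ℝ) : ℂ) • B j) := by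
        have : Complex.I • ∑ j ∈ S, ((s * y j : ℝ) : ℂ) • B j =
          (s : ℂ) • (Complex.I • ∑ j ∈ S, (y j : ℂ) • B j) := by
          rw [Finset.smul_sum, Finset.smul_sum, Finset.smul_sum]
          refine Finset.sum_congr rfl fun j _ => ?_
          rw [smul_comm (s : ℂ), smul_smul (s : ℂ)]; push_cast; rfl
        rw [this]
        funext p
        simp only [mvec, Pi.add_apply, Matrix.add_apply, Pi.smul_apply, Matrix.smul_apply]
        ring
      simp only [e, aeval_sigPoly]
      exact ih _ (hX.add (real_smul_herm _ (hB a) r)) α hα _ fun j => mul_nonneg hs.1 (hy j)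
    · intro t ht
      have e : mvec (X + (Complex.I * α) • 1 + ((0:ℝ) : ℂ) • (Complex.I • ∑ j ∈ S, (y j : ℂ) • B j)) +
          t • mvec (B a) = mvec (X + (Complex.I * α) • 1 + t • B a) := by
        rw [Complex.ofReal_zero, zero_smul, add_zero]; rfl
      simp only [e, aeval_sigPoly]
      exact cone1 hmn (B a) (hB a) (hG a) X hX α hα t ht
end mat

lemma polar {m : ℕ} (hm : 1 ≤ m) (R : MvPolynomial (Fin m) ℝ) (hR : R.IsHomogeneous m) :
    ∑ T ∈ (Finset.univ : Finset (Finset (Fin m))).filter (fun T => T ≠ ∅),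
      (-1 : ℝ) ^ (m - T.card) * MvPolynomial.aeval (fun i => if i ∈ T then (1 : ℝ) else 0) R =
    R.coeff (∑ i ∈ (Finset.univ : Finset (Fin m)), Finsupp.single i 1) := by
  classical
  have hdeg : ∀ d ∈ R.support, ∑ i, d i = m := by
    intro d hd
    have h1 := hR (MvPolynomial.mem_support_iff.1 hd)
    have h2 := Finsupp.degree_eq_weight_one (R := ℕ) (σ := Fin m)
    have h3 := congrArg (fun g => g d) h2
    rw [← Finsupp.degree_eq_sum]
    exact h3.trans h1
  have hcomb : ∀ d : Fin m →₀ ℕ, ∑ T : Finset (Fin m), (-1 : ℝ) ^ (m - T.card) *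
      ∏ i, (if i ∈ T then (1 : ℝ) else 0) ^ d i = ∏ i, (1 + -((0 : ℝ) ^ d i)) := by
    intro d
    rw [Fintype.prod_add]
    refine Finset.sum_congr rfl fun T _ => ?_
    rw [Finset.prod_const_one, one_mul, Finset.prod_neg, Finset.card_compl, Fintype.card_fin]
    congr 1
    rw [← Finset.prod_mul_prod_compl T]
    rw [Finset.prod_congr rfl (g := fun _ => (1 : ℝ)) (fun i hi => by simp [hi]),
      Finset.prod_const_one, one_mul]
    refine Finset.prod_congr rfl fun i hi => ?_
    rw [if_neg (Finset.mem_compl.1 hi)]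
  have hfilt : ∑ T ∈ (Finset.univ : Finset (Finset (Fin m))).filter (fun T => T ≠ ∅),
      (-1 : ℝ) ^ (m - T.card) * MvPolynomial.aeval (fun i => if i ∈ T then (1 : ℝ) else 0) R =
      ∑ T : Finset (Fin m),
      (-1 : ℝ) ^ (m - T.card) * MvPolynomial.aeval (fun i => if i ∈ T then (1 : ℝ) else 0) R := by
    refine Finset.sum_filter_of_ne fun T _ h hT => h ?_
    subst hT
    have := homog_smul R hR (0 : ℝ) (fun _ => (0 : ℝ))
    rw [zero_pow (by omega), zero_mul] at this
    have e : (fun i : Fin m => if i ∈ (∅ : Finset (Fin m)) then (1 : ℝ) else 0) =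
      (0 : ℝ) • fun _ => (0 : ℝ) := by
      funext i; simp
    rw [e, this, mul_zero]
  rw [hfilt]
  have hae : ∀ x : Fin m → ℝ, MvPolynomial.aeval x R =
      ∑ d ∈ R.support, R.coeff d * ∏ i, x i ^ d i := fun x => MvPolynomial.eval_eq' x R
  simp only [hae, Finset.mul_sum]
  rw [Finset.sum_comm]
  have h3 : ∀ d ∈ R.support, ∑ T : Finset (Fin m), (-1 : ℝ) ^ (m - T.card) *
      (R.coeff d * ∏ i, (if i ∈ T then (1 : ℝ) else 0) ^ d i) =
      if d = ∑ i ∈ (Finset.univ : Finset (Fin m)), Finsupp.single i 1 then R.coeff d else 0 := by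
    intro d hd
    have : ∑ T : Finset (Fin m), (-1 : ℝ) ^ (m - T.card) *
      (R.coeff d * ∏ i, (if i ∈ T then (1 : ℝ) else 0) ^ d i) =
      R.coeff d * ∑ T : Finset (Fin m), (-1 : ℝ) ^ (m - T.card) *
      ∏ i, (if i ∈ T then (1 : ℝ) else 0) ^ d i := by
      rw [Finset.mul_sum]
      exact Finset.sum_congr rfl fun T _ => by ring
    rw [this, hcomb]
    have hone : ∀ j, (∑ i ∈ (Finset.univ : Finset (Fin m)), Finsupp.single i 1 : Fin m →₀ ℕ) j = 1 := by
      intro j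
      simp [Finsupp.finsetSum_apply, Finsupp.single_apply]
    split_ifs with h
    · rw [Finset.prod_eq_one, mul_one]
      intro i _
      rw [h, hone]; simp
    · have : ∃ i, d i = 0 := by
        by_contra hc
        push Not at hc
        apply h
        have hle : ∀ i ∈ (Finset.univ : Finset (Fin m)), 1 ≤ d i := fun i _ => Nat.one_le_iff_ne_zero.2 (hc i)
        have heq : ∑ i : Fin m, 1 = ∑ i, d i := by rw [hdeg d hd]; simp
        have := (Finset.sum_eq_sum_iff_of_le hle).1 heq
        ext j
        rw [hone, ← this j (Finset.mem_univ j)]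
      obtain ⟨i, hi⟩ := this
      rw [Finset.prod_eq_zero (Finset.mem_univ i), mul_zero]
      rw [hi]; simp
  rw [Finset.sum_congr rfl h3, Finset.sum_ite_eq']
  split_ifs with h
  · rfl
  · exact (MvPolynomial.notMem_support_iff.1 h).symm

section fin
variable {n : ℕ}

lemma hess_herm (u : (Fin n → ℂ) → ℝ) (Ω : Set (Fin n → ℂ)) (hΩ : IsOpen Ω)
    (hu : ContDiffOn ℝ 2 u Ω) (z : Fin n → ℂ) (hz : z ∈ Ω) :
    (complexHessian u Ω z).IsHermitian := by
  have hs : IsSymmSndFDerivWithinAt ℝ u Ω z := by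
    refine ContDiffWithinAt.isSymmSndFDerivWithinAt (n := 2) (hu z hz) (by simp) hΩ.uniqueDiffOn ?_ hz
    rw [hΩ.interior_eq]; exact subset_closure hz
  have hsym : ∀ a b, iteratedFDerivWithin ℝ 2 u Ω z ![a, b] =
      iteratedFDerivWithin ℝ 2 u Ω z ![b, a] := fun a b =>
    IsSymmSndFDerivWithinAt.iteratedFDerivWithin_cons (hf := hs) hΩ.uniqueDiffOn hz
  ext j k
  rw [Matrix.conjTranspose_apply]
  unfold complexHessian
  dsimp only
  rw [hsym (Pi.single k 1) (Pi.single j 1), hsym (Complex.I • Pi.single k 1) (Complex.I • Pi.single j 1),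
    hsym (Pi.single k 1) (Complex.I • Pi.single j 1), hsym (Complex.I • Pi.single k 1) (Pi.single j 1)]
  simp only [star_add, star_mul', RCLike.star_def, Complex.conj_ofReal, Complex.conj_I]
  push_cast
  ring

lemma sigC_conjTranspose (k : ℕ) (A : Matrix (Fin n) (Fin n) ℂ) :
    sigC k A.conjTranspose = starRingEnd ℂ (sigC k A) := by
  unfold sigC
  rw [map_sum]
  refine Finset.sum_congr rfl fun S _ => ?_
  have := Matrix.det_conjTranspose (M := A.submatrix (fun i : S => (i : Fin n)) (fun j : S => (j : Fin n)))
  rw [Matrix.conjTranspose_submatrix] at this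
  exact this

lemma pencil {m : ℕ} (B : Fin m → Matrix (Fin n) (Fin n) ℂ) (hB : ∀ j, (B j).IsHermitian) :
    ∃ R : MvPolynomial (Fin m) ℝ, R.IsHomogeneous m ∧
      ∀ z : Fin m → ℂ, MvPolynomial.aeval z R = sigC m (∑ k, z k • B k) := by
  let Rc : MvPolynomial (Fin m) ℂ := MvPolynomial.aeval
    (fun p : Fin n × Fin n => ∑ k, MvPolynomial.C (B k p.1 p.2) * MvPolynomial.X k) (sigPoly n m)
  have hh : Rc.IsHomogeneous m := by
    have := (sigPoly_homog (n := n) m).aeval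
      (fun p : Fin n × Fin n => ∑ k, MvPolynomial.C (B k p.1 p.2) * MvPolynomial.X k) (n := 1) (fun p =>
        MvPolynomial.IsHomogeneous.sum _ _ _ fun k _ => MvPolynomial.isHomogeneous_C_mul_X _ _)
    rw [one_mul] at this
    exact this
  have hev : ∀ z : Fin m → ℂ, MvPolynomial.eval z Rc = sigC m (∑ k, z k • B k) := by
    intro z
    rw [← aeval_sigPoly, ← MvPolynomial.coe_aeval_eq_eval]
    change MvPolynomial.aeval z (MvPolynomial.aeval _ _) = _
    have h1 := MvPolynomial.comp_aeval_apply
      (fun p : Fin n × Fin n => ∑ k, MvPolynomial.C (B k p.1 p.2) * MvPolynomial.X k)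
      (MvPolynomial.aeval (R := ℂ) z) (sigPoly n m)
    rw [h1]
    congr 2
    funext p
    simp [mvec, Matrix.sum_apply, mul_comm]
  have hconj : MvPolynomial.map (starRingEnd ℂ) Rc = Rc := by
    apply MvPolynomial.funext
    intro x
    have h1 : MvPolynomial.eval x (MvPolynomial.map (starRingEnd ℂ) Rc) =
        starRingEnd ℂ (MvPolynomial.eval (fun i => starRingEnd ℂ (x i)) Rc) := by
      rw [MvPolynomial.map_eval]
      congr 2
      funext i
      simp
    rw [h1, hev, hev, ← sigC_conjTranspose]
    congr 1
    rw [Matrix.conjTranspose_sum]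
    refine Finset.sum_congr rfl fun k _ => ?_
    rw [Matrix.conjTranspose_smul, (hB k).eq]
    simp
  have hmem : Rc ∈ Set.range (MvPolynomial.map (σ := Fin m) (algebraMap ℝ ℂ)) := by
    rw [MvPolynomial.mem_range_map_iff_coeffs_subset]
    intro c hc
    obtain ⟨d, hd, rfl⟩ := MvPolynomial.mem_coeffs_iff.1 hc
    have := congrArg (MvPolynomial.coeff d) hconj
    rw [MvPolynomial.coeff_map] at this
    exact ⟨_, Complex.conj_eq_iff_re.1 this⟩
  obtain ⟨R, hR⟩ := hmem
  refine ⟨R, MvPolynomial.IsHomogeneous.of_map (f := algebraMap ℝ ℂ) (algebraMap ℝ ℂ).injective (by rwa [hR]), ?_⟩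
  intro z
  rw [← hev, ← hR, MvPolynomial.eval_map, MvPolynomial.aeval_def]

lemma sum_herm {ι : Type*} (S : Finset ι) (B : ι → Matrix (Fin n) (Fin n) ℂ)
    (hB : ∀ j, (B j).IsHermitian) (x : ι → ℝ) : (∑ k ∈ S, (x k : ℂ) • B k).IsHermitian := by
  unfold Matrix.IsHermitian
  rw [Matrix.conjTranspose_sum]
  exact Finset.sum_congr rfl fun k _ => (real_smul_herm (B k) (hB k) (x k)).eq

lemma perturbed {m : ℕ} (hm : 1 ≤ m) (hmn : m ≤ n) (A : Fin m → Matrix (Fin n) (Fin n) ℂ)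
    (hA : ∀ j, (A j).IsHermitian)
    (hG : ∀ j, ∀ k, 1 ≤ k → k ≤ m → 0 ≤ sigmaMinor k (A j)) (ε : ℝ) (hε : 0 < ε) :
    ∏ j, sigmaMinor m (A j + ((2 * ε : ℝ) : ℂ) • 1) ≤
      Dpol (fun j => A j + ((2 * ε : ℝ) : ℂ) • 1) ^ m := by
  obtain ⟨k, rfl⟩ : ∃ k, m = k + 1 := ⟨m - 1, by omega⟩
  set B : Fin (k + 1) → Matrix (Fin n) (Fin n) ℂ := fun j => A j + ((2 * ε : ℝ) : ℂ) • 1 with hBdef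
  have hB : ∀ j, (B j).IsHermitian := fun j => herm_shift _ (hA j) _
  have hB' : ∀ j, (A j + (ε : ℂ) • 1).IsHermitian := fun j => herm_shift _ (hA j) _
  obtain ⟨R, hRh, hR⟩ := pencil B hB
  have hre : ∀ x : Fin (k + 1) → ℝ, MvPolynomial.aeval x R = sigmaMinor (k + 1) (∑ i, (x i : ℂ) • B i) := by
    intro x
    have h := hR (fun i => (x i : ℂ))
    rw [aeval_ofReal, sig_real _ (sum_herm _ B hB x)] at h
    exact_mod_cast h
  have hsingle : ∀ j, MvPolynomial.aeval (Pi.single j (1 : ℝ)) R = sigmaMinor (k + 1) (B j) := by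
    intro j
    rw [hre, Finset.sum_eq_single j]
    · simp
    · intro i _ hij; simp [hij]
    · simp
  have hst : StrongStable R := by
    intro z hz hz'
    rw [hR]
    have hα : 0 < ε * ∑ i, (z i).im := by
      refine mul_pos hε ?_
      obtain ⟨i, hi⟩ := hz'
      exact Finset.sum_pos' (fun i _ => hz i) ⟨i, Finset.mem_univ i, hi⟩
    have := cone2 hmn (fun j => A j + (ε : ℂ) • 1) hB' (fun j s hs => by
      have h := sig_pos (A j) (hA j) (hG j) (ε + s) (by linarith) le_rfl hmn
      have e : A j + (ε : ℂ) • (1 : Matrix (Fin n) (Fin n) ℂ) + (s : ℂ) • 1 = A j + ((ε + s : ℝ) : ℂ) • 1 := by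
        rw [Complex.ofReal_add, add_smul, add_assoc]
      rw [e]; exact h) Finset.univ (∑ i, ((z i).re : ℂ) • B i) (sum_herm _ B hB _)
      (ε * ∑ i, (z i).im) hα (fun i => (z i).im) hz
    convert this using 2
    have e1 : (Complex.I * ((ε * ∑ i, (z i).im : ℝ) : ℂ)) • (1 : Matrix (Fin n) (Fin n) ℂ) =
        ∑ i, (Complex.I * ε * (z i).im) • (1 : Matrix (Fin n) (Fin n) ℂ) := by
      rw [← Finset.sum_smul]
      congr 1
      push_cast
      rw [Finset.mul_sum, Finset.mul_sum]
      exact Finset.sum_congr rfl fun i _ => by ring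
    rw [e1, Finset.smul_sum, ← Finset.sum_add_distrib, ← Finset.sum_add_distrib]
    refine Finset.sum_congr rfl fun i _ => ?_
    have e2 : B i = (A i + (ε : ℂ) • 1) + (ε : ℂ) • 1 := by
      rw [hBdef]
      push_cast
      rw [two_mul, add_smul, add_assoc]
    conv_lhs => rw [← Complex.re_add_im (z i)]
    rw [add_smul, e2]
    ext a b
    simp only [Matrix.add_apply, Matrix.smul_apply, smul_eq_mul]
    ring
  have hg := (garding k R hRh hst (fun j => by
    rw [hsingle]
    exact sig_pos (A j) (hA j) (hG j) (2 * ε) (by linarith) le_rfl hmn) Finset.univ (by simp)).2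
  have hD : Dpol B = R.coeff (∑ i ∈ Finset.univ, Finsupp.single i 1) / ((k + 1).factorial : ℝ) := by
    rw [← polar hm R hRh, Dpol, div_eq_inv_mul]
    congr 1
    refine Finset.sum_congr rfl fun T _ => ?_
    rw [hre]
    congr 2
    have e : ∀ i, (((if i ∈ T then (1 : ℝ) else 0) : ℝ) : ℂ) • B i = if i ∈ T then B i else 0 := by
      intro i; split_ifs <;> simp
    simp only [e, Finset.sum_ite_mem, Finset.univ_inter]
  rw [hD]
  simpa only [hsingle] using hg

lemma sigmaMinor_cont (k : ℕ) : Continuous (fun A : Matrix (Fin n) (Fin n) ℂ => sigmaMinor k A) := by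
  unfold sigmaMinor
  refine Complex.continuous_re.comp (continuous_finsetSum _ fun S _ => ?_)
  exact Continuous.matrix_det (continuous_id.matrix_submatrix _ _)

theorem mixed_matrix {m : ℕ} (hm : 1 ≤ m) (hmn : m ≤ n) (A : Fin m → Matrix (Fin n) (Fin n) ℂ)
    (hA : ∀ j, (A j).IsHermitian)
    (hG : ∀ j, ∀ k, 1 ≤ k → k ≤ m → 0 ≤ sigmaMinor k (A j)) :
    ∏ j, sigmaMinor m (A j) ≤ Dpol A ^ m := by
  have c1 : ∀ j, Continuous fun ε : ℝ => A j + ((2 * ε : ℝ) : ℂ) • (1 : Matrix (Fin n) (Fin n) ℂ) := by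
    intro j; fun_prop
  have hl : Continuous fun ε : ℝ => ∏ j, sigmaMinor m (A j + ((2 * ε : ℝ) : ℂ) • 1) :=
    continuous_finsetProd _ fun j _ => (sigmaMinor_cont m).comp (c1 j)
  have hr : Continuous fun ε : ℝ => Dpol (fun j => A j + ((2 * ε : ℝ) : ℂ) • 1) ^ m := by
    unfold Dpol
    refine Continuous.pow (continuous_const.mul (continuous_finsetSum _ fun T _ =>
      continuous_const.mul ((sigmaMinor_cont m).comp (continuous_finsetSum _ fun j _ => c1 j)))) _
  have h := le_of_tendsto_of_tendsto (b := nhdsWithin (0 : ℝ) (Set.Ioi 0))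
    ((hl.tendsto 0).mono_left nhdsWithin_le_nhds) ((hr.tendsto 0).mono_left nhdsWithin_le_nhds)
    (Filter.eventually_of_mem self_mem_nhdsWithin fun ε hε => perturbed hm hmn A hA hG ε hε)
  simpa using h

end fin

/-- Smooth local mixed Hessian inequality (Lemma 2.2 of the paper, flat metric):
if `u₁,…,u_m` are `C²` on an open `Ω ⊆ ℂⁿ` with `σ_k(H(u_j)) ≥ 0` on `Ω` for all
`k = 1,…,m` (each `u_j` is `m`-subharmonic), and `σ_m(H(u_j)) ≥ f_j ≥ 0` on `Ω`, then
`D_m(H(u₁),…,H(u_m))^m ≥ f₁ ⋯ f_m` on `Ω`. -/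
theorem smooth_mixed_hessian_inequality {n m : ℕ} (hn : 1 ≤ n) (hm : 1 ≤ m) (hmn : m ≤ n)
    (Ω : Set (Fin n → ℂ)) (hΩ : IsOpen Ω)
    (u : Fin m → (Fin n → ℂ) → ℝ) (hu : ∀ j, ContDiffOn ℝ 2 (u j) Ω)
    (f : Fin m → (Fin n → ℂ) → ℝ) (hf : ∀ j, ∀ z ∈ Ω, 0 ≤ f j z)
    (hmsh : ∀ j, ∀ k, 1 ≤ k → k ≤ m → ∀ z ∈ Ω,
      0 ≤ sigmaMinor k (complexHessian (u j) Ω z))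
    (hfm : ∀ j, ∀ z ∈ Ω, f j z ≤ sigmaMinor m (complexHessian (u j) Ω z)) :
    ∀ z ∈ Ω, Dpol (fun j => complexHessian (u j) Ω z) ^ m ≥ ∏ j, f j z := by
  intro z hz
  have h := mixed_matrix hm hmn (fun j => complexHessian (u j) Ω z)
    (fun j => hess_herm (u j) Ω hΩ (hu j) z hz) (fun j k h1 h2 => hmsh j k h1 h2 z hz)
  exact le_trans (Finset.prod_le_prod (fun j _ => hf j z hz) fun j _ => hfm j z hz) h
end

section
/- Smooth two-potential mixed Hessian inequality (Theorem 3.7 of the paper, smooth flat case): let Ω ⊆ ℂ^n be open and u, v : Ω → ℝ twice continuously differentiable functions whose complex Hessian matrices satisfy σ_j(H(u)(z)) ≥ 0 and σ_j(H(v)(z)) ≥ 0 for every j = 1,…,m and every z ∈ Ω. Let f, g : Ω → ℝ be nonnegative functions with σ_m(H(u)(z)) ≥ f(z) and σ_m(H(v)(z)) ≥ g(z) for all z ∈ Ω. Then for every k with 0 ≤ k ≤ m and every z ∈ Ω, D_m(H(u)(z),…,H(u)(z), H(v)(z),…,H(v)(z)) ≥ f(z)^{k/m} · g(z)^{(m−k)/m},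 where H(u)(z) appears k times and H(v)(z) appears m−k times, and real powers are taken with nonnegative base. -/
theorem det_charpoly_shift {n : ℕ} (M : Matrix (Fin n) (Fin n) ℂ) (w : ℂ) :
    (-(w • (1 : Matrix (Fin n) (Fin n) ℂ) + M)).charpoly = Polynomial.taylor w (-M).charpoly := by
  rw [Polynomial.taylor_apply, Matrix.charpoly, Matrix.charpoly]
  have h := RingHom.map_det (Polynomial.compRingHom (Polynomial.X + Polynomial.C w)) (Matrix.charmatrix (-M))
  simp only [Polynomial.coe_compRingHom_apply] at h
  rw [h]
  congr 1
  ext1 i j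
  by_cases hij : i = j
  · subst hij; simp; ring
  · simp [hij]

/-- Complex-valued sum of the principal minors. -/
noncomputable def eSig {n : ℕ} (k : ℕ) (A : Matrix (Fin n) (Fin n) ℂ) : ℂ :=
  ∑ S ∈ Finset.powersetCard k (Finset.univ : Finset (Fin n)),
    (A.submatrix (fun i : S => (i : Fin n)) (fun j : S => (j : Fin n))).det

theorem charpoly_neg_coeff {n : ℕ} (M : Matrix (Fin n) (Fin n) ℂ) (k : ℕ) (hk : k ≤ n) :
    (-M).charpoly.coeff (n - k) = eSig k M := by
  have h := Matrix.charpoly_coeff_eq_sum_minors (-M) k (by simpa using hk)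
  simp only [Fintype.card_fin] at h
  rw [h, eSig, Finset.mul_sum]
  refine Finset.sum_congr rfl fun S hS => ?_
  have hc := (Finset.mem_powersetCard.mp hS).2
  rw [Matrix.submatrix_neg, Pi.neg_apply, Pi.neg_apply, Matrix.det_neg, Fintype.card_coe, hc, ← mul_assoc, ← mul_pow]
  simp

theorem eSig_shift {n m : ℕ} (hm : m ≤ n) (M : Matrix (Fin n) (Fin n) ℂ) (w : ℂ) :
    eSig m (w • (1 : Matrix (Fin n) (Fin n) ℂ) + M) =
      (Polynomial.hasseDeriv (n - m) (-M).charpoly).eval w := by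
  rw [← charpoly_neg_coeff _ _ hm, det_charpoly_shift, Polynomial.taylor_coeff]

theorem eSig_shift_expand {n m : ℕ} (hm : m ≤ n) (M : Matrix (Fin n) (Fin n) ℂ) (w : ℂ) :
    eSig m (w • (1 : Matrix (Fin n) (Fin n) ℂ) + M) =
      ∑ i ∈ Finset.range (m + 1), ((i + (n - m)).choose (n - m) : ℂ) * eSig (m - i) M * w ^ i := by
  rw [eSig_shift hm, Polynomial.eval_eq_sum_range' (n := m + 1)]
  · refine Finset.sum_congr rfl fun i hi => ?_
    have hi' : i ≤ m := by simpa [Nat.lt_succ_iff] using hi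
    rw [Polynomial.hasseDeriv_coeff, ← charpoly_neg_coeff M (m - i) (by omega)]
    congr 4
    omega
  · have := Polynomial.natDegree_hasseDeriv_le (-M).charpoly (n - m)
    have h2 := Matrix.charpoly_natDegree_eq_dim (-M)
    rw [Fintype.card_fin] at h2
    omega

theorem derivative_real_rooted (P : Polynomial ℂ) (hP : ∀ z, P.eval z = 0 → z.im = 0)
    (hd : 0 < P.natDegree) : ∀ z, P.derivative.eval z = 0 → z.im = 0 := by
  intro z hz
  have hd' : 0 < P.degree := Polynomial.natDegree_pos_iff_degree_pos.mp hd
  have h0 : P.derivative ≠ 0 := by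
    intro h
    have := Polynomial.derivative_eq_zero.mp h
    omega
  have h1 : z ∈ P.derivative.rootSet ℂ := by
    rw [Polynomial.mem_rootSet]; exact ⟨h0, by simpa using hz⟩
  have h2 := Polynomial.rootSet_derivative_subset_convexHull_rootSet hd' h1
  have h3 : convexHull ℝ (P.rootSet ℂ) ⊆ {z : ℂ | z.im = 0} := by
    apply convexHull_min
    · intro y hy
      rw [Polynomial.mem_rootSet] at hy
      exact hP y (by simpa using hy.2)
    · intro x hx y hy a b _ _ _
      simp only [Set.mem_ofPred_eq] at *
      simp [hx, hy]
  exact h3 h2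

theorem iterate_derivative_real_rooted (k : ℕ) (P : Polynomial ℂ) (hP : ∀ z, P.eval z = 0 → z.im = 0)
    (hd : k ≤ P.natDegree) : (∀ z, (Polynomial.derivative^[k] P).eval z = 0 → z.im = 0) ∧
      (Polynomial.derivative^[k] P).natDegree = P.natDegree - k := by
  induction k with
  | zero => simpa using hP
  | succ k ih =>
    obtain ⟨h1, h2⟩ := ih (by omega)
    rw [Function.iterate_succ_apply']
    refine ⟨derivative_real_rooted _ h1 (by omega), ?_⟩
    rw [Polynomial.natDegree_derivative, h2]
    omega

theorem eSig_shift_ne_zero {n m : ℕ} (hm : m ≤ n) (M : Matrix (Fin n) (Fin n) ℂ)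
    (hM : M.IsHermitian) (w : ℂ) (hw : w.im ≠ 0) :
    eSig m (w • (1 : Matrix (Fin n) (Fin n) ℂ) + M) ≠ 0 := by
  rw [eSig_shift hm]
  intro h
  have hd : (-M).charpoly.natDegree = n := by simpa using Matrix.charpoly_natDegree_eq_dim (-M)
  have h1 := (iterate_derivative_real_rooted (n - m) (-M).charpoly ?_ (by omega)).1 w ?_
  · exact hw h1
  · intro z hz
    rw [hM.neg.charpoly_eq, Polynomial.eval_prod, Finset.prod_eq_zero_iff] at hz
    obtain ⟨i, _, hi⟩ := hz
    simp only [Polynomial.eval_sub, Polynomial.eval_X, Polynomial.eval_C, sub_eq_zero] at hi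
    rw [hi]; simp
  · rw [← Polynomial.factorial_smul_hasseDeriv]
    simp [h]

theorem eSig_pol {n : ℕ} (m : ℕ) (A M : Matrix (Fin n) (Fin n) ℂ) :
    ∃ Q : Polynomial ℂ, Q.natDegree ≤ m ∧ Q.coeff m = eSig m A ∧ Q.coeff 0 = eSig m M ∧
      ∀ t, Q.eval t = eSig m (t • A + M) := by
  refine ⟨∑ S ∈ Finset.powersetCard m (Finset.univ : Finset (Fin n)),
    ((Polynomial.X : Polynomial ℂ) •
        (A.submatrix (fun i : S => (i : Fin n)) (fun j : S => (j : Fin n))).map Polynomial.C +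
      (M.submatrix (fun i : S => (i : Fin n)) (fun j : S => (j : Fin n))).map Polynomial.C).det,
    ?_, ?_, ?_, ?_⟩
  · refine Polynomial.natDegree_sum_le_of_forall_le _ _ fun S hS => ?_
    have := Polynomial.natDegree_det_X_add_C_le
      (A.submatrix (fun i : S => (i : Fin n)) (fun j : S => (j : Fin n)))
      (M.submatrix (fun i : S => (i : Fin n)) (fun j : S => (j : Fin n)))
    rwa [Fintype.card_coe, (Finset.mem_powersetCard.mp hS).2] at this
  · rw [Polynomial.finsetSum_coeff, eSig]
    refine Finset.sum_congr rfl fun S hS => ?_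
    have := Polynomial.coeff_det_X_add_C_card
      (A.submatrix (fun i : S => (i : Fin n)) (fun j : S => (j : Fin n)))
      (M.submatrix (fun i : S => (i : Fin n)) (fun j : S => (j : Fin n)))
    rwa [Fintype.card_coe, (Finset.mem_powersetCard.mp hS).2] at this
  · rw [Polynomial.finsetSum_coeff, eSig]
    exact Finset.sum_congr rfl fun S hS => Polynomial.coeff_det_X_add_C_zero _ _
  · intro t
    rw [Polynomial.eval_finsetSum, eSig]
    refine Finset.sum_congr rfl fun S hS => ?_
    have := RingHom.map_det (Polynomial.evalRingHom t) ((Polynomial.X : Polynomial ℂ) •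
        (A.submatrix (fun i : S => (i : Fin n)) (fun j : S => (j : Fin n))).map Polynomial.C +
      (M.submatrix (fun i : S => (i : Fin n)) (fun j : S => (j : Fin n))).map Polynomial.C)
    rw [Polynomial.coe_evalRingHom] at this
    rw [this]
    congr 1
    ext i j
    simp
    exact mul_comm _ _

theorem eSig_smul {n : ℕ} (m : ℕ) (c : ℂ) (M : Matrix (Fin n) (Fin n) ℂ) :
    eSig m (c • M) = c ^ m * eSig m M := by
  rw [eSig, eSig, Finset.mul_sum]
  refine Finset.sum_congr rfl fun S hS => ?_
  have := Matrix.det_smul (M.submatrix (fun i : S => (i : Fin n)) (fun j : S => (j : Fin n))) c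
  rw [Fintype.card_coe, (Finset.mem_powersetCard.mp hS).2] at this
  rw [← this]
  rfl

theorem continuous_eSig {n : ℕ} (m : ℕ) :
    Continuous (fun M : Matrix (Fin n) (Fin n) ℂ => eSig m M) := by
  unfold eSig
  refine continuous_finsetSum _ fun S _ => ?_
  exact Continuous.matrix_det (Continuous.matrix_submatrix continuous_id _ _)

theorem eSig_im {n : ℕ} (m : ℕ) (M : Matrix (Fin n) (Fin n) ℂ) (hM : M.IsHermitian) :
    (eSig m M).im = 0 := by
  unfold eSig
  rw [Complex.im_sum]
  refine Finset.sum_eq_zero fun S _ => ?_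
  have h := hM.submatrix (fun i : S => (i : Fin n))
  have h2 := Matrix.det_conjTranspose (M.submatrix (fun i : S => (i : Fin n)) (fun i : S => (i : Fin n)))
  rw [h.eq] at h2
  exact Complex.conj_eq_iff_im.mp h2.symm

theorem eSig_re {n : ℕ} (m : ℕ) (M : Matrix (Fin n) (Fin n) ℂ) :
    (eSig m M).re = sigmaMinor m M := rfl

theorem norm_prod_ge (s : Multiset ℂ) (hs : ∀ r ∈ s, r.im < 0) (t : ℂ) (ht : 0 ≤ t.im) :
    t.im ^ (Multiset.card s) ≤ ‖(s.map (fun r => t - r)).prod‖ := by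
  induction s using Multiset.induction_on with
  | empty => simp
  | cons a s ih =>
    have h1 := ih (fun r hr => hs r (Multiset.mem_cons_of_mem hr))
    have h2 := hs a (Multiset.mem_cons_self a s)
    rw [Multiset.map_cons, Multiset.prod_cons, norm_mul, Multiset.card_cons, pow_succ']
    have h3 : t.im ≤ ‖t - a‖ := by
      have := Complex.abs_im_le_norm (t - a)
      rw [Complex.sub_im] at this
      have := le_abs_self (t.im - a.im)
      linarith
    exact mul_le_mul h3 h1 (by positivity) (by positivity)

theorem poly_lower_bound (Q : Polynomial ℂ) (m : ℕ) (hd : Q.natDegree ≤ m) (hc : Q.coeff m ≠ 0)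
    (hr : ∀ t : ℂ, 0 ≤ t.im → Q.eval t ≠ 0) (t : ℂ) (ht : 0 ≤ t.im) :
    ‖Q.coeff m‖ * t.im ^ m ≤ ‖Q.eval t‖ := by
  have hdm : Q.natDegree = m := le_antisymm hd (Polynomial.le_natDegree_of_ne_zero hc)
  have hs : Q.Splits := IsAlgClosed.splits Q
  have hcard : Multiset.card Q.roots = m := by
    rw [← hdm]; exact (Polynomial.splits_iff_card_roots.mp hs)
  rw [hs.eval_eq_prod_roots, norm_mul, Polynomial.leadingCoeff, hdm]
  have := norm_prod_ge Q.roots (fun r hr' => by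
    by_contra h
    push Not at h
    exact hr r h (Polynomial.isRoot_of_mem_roots hr')) t ht
  rw [hcard] at this
  exact mul_le_mul_of_nonneg_left this (norm_nonneg _)

theorem eSig_lower_bound {n : ℕ} (m : ℕ) (A M : Matrix (Fin n) (Fin n) ℂ) (hA : eSig m A ≠ 0)
    (hr : ∀ t : ℂ, 0 ≤ t.im → eSig m (t • A + M) ≠ 0) (t : ℂ) (ht : 0 ≤ t.im) :
    ‖eSig m A‖ * t.im ^ m ≤ ‖eSig m (t • A + M)‖ := by
  obtain ⟨Q, h1, h2, -, h4⟩ := eSig_pol m A M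
  rw [← h4, ← h2]
  exact poly_lower_bound Q m h1 (by rwa [h2]) (fun t ht => by rw [h4]; exact hr t ht) t ht

theorem homotopy_roots {n : ℕ} (m : ℕ) (A : Matrix (Fin n) (Fin n) ℂ) (hA : eSig m A ≠ 0)
    (M : ℝ → Matrix (Fin n) (Fin n) ℂ) (hM : Continuous M)
    (hreal : ∀ s ∈ Set.Icc (0 : ℝ) 1, ∀ t : ℝ, eSig m ((t : ℂ) • A + M s) ≠ 0)
    (h0 : ∀ t : ℂ, 0 ≤ t.im → eSig m (t • A + M 0) ≠ 0) :
    ∀ t : ℂ, 0 ≤ t.im → eSig m (t • A + M 1) ≠ 0 := by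
  set G : Set ℝ := {s | ∀ t : ℂ, 0 ≤ t.im → eSig m (t • A + M s) ≠ 0} with hG
  have hclosed : IsClosed (G ∩ Set.Icc (0 : ℝ) 1) := by
    have : G ∩ Set.Icc (0 : ℝ) 1 = Set.Icc (0 : ℝ) 1 ∩
        ⋂ (t : ℂ) (_ : 0 ≤ t.im), {s | ‖eSig m A‖ * t.im ^ m ≤ ‖eSig m (t • A + M s)‖} := by
      ext s
      simp only [Set.mem_inter_iff, Set.mem_iInter, hG, Set.mem_ofPred_eq]
      constructor
      · rintro ⟨h1, h2⟩
        exact ⟨h2, fun t ht => eSig_lower_bound m A (M s) hA h1 t ht⟩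
      · rintro ⟨h1, h2⟩
        refine ⟨fun t ht => ?_, h1⟩
        rcases ht.eq_or_lt with h | h
        · have : t = (t.re : ℂ) := by apply Complex.ext <;> simp [← h]
          rw [this]; exact hreal s h1 _
        · have h3 := h2 t ht
          have : 0 < ‖eSig m A‖ * t.im ^ m := mul_pos (norm_pos_iff.mpr hA) (by positivity)
          exact norm_pos_iff.mp (lt_of_lt_of_le this h3)
    rw [this]
    refine isClosed_Icc.inter (isClosed_iInter fun t => isClosed_iInter fun _ => ?_)
    refine isClosed_le continuous_const ?_
    exact ((continuous_eSig m).comp (continuous_const.add hM)).norm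
  have hsub := hclosed.Icc_subset_of_forall_mem_nhdsWithin (a := (0 : ℝ)) (b := 1) h0 ?_
  · exact hsub (by simp)
  rintro x ⟨hx, -⟩
  apply mem_nhdsWithin_of_mem_nhds
  have hc1 : Continuous (fun p : ℝ × ℂ => eSig m (A + p.2 • M p.1)) :=
    (continuous_eSig m).comp (continuous_const.add (continuous_snd.smul (hM.comp continuous_fst)))
  have hc2 : Continuous (fun p : ℝ × ℂ => eSig m (p.2 • A + M p.1)) :=
    (continuous_eSig m).comp ((continuous_snd.smul continuous_const).add (hM.comp continuous_fst))
  have h1 : ∀ᶠ p in nhds ((x, 0) : ℝ × ℂ), eSig m (A + p.2 • M p.1) ≠ 0 :=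
    hc1.continuousAt.eventually_ne (by simpa using hA)
  rw [nhds_prod_eq, Filter.eventually_prod_iff] at h1
  obtain ⟨pa, hpa, pb, hpb, hab⟩ := h1
  obtain ⟨δ, hδ, hball⟩ := Metric.eventually_nhds_iff.mp hpb
  have hK : IsCompact (Metric.closedBall (0 : ℂ) (2 / δ) ∩ {t : ℂ | 0 ≤ t.im}) :=
    (isCompact_closedBall _ _).inter_right (isClosed_le continuous_const Complex.continuous_im)
  have h2 := hK.eventually_forall_of_forall_eventually (x₀ := x)
    (P := fun s t => eSig m (t • A + M s) ≠ 0) (fun t ht =>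
      hc2.continuousAt.eventually_ne (hx t ht.2))
  filter_upwards [hpa, h2] with s hs1 hs2 t ht
  by_cases hR : ‖t‖ ≤ 2 / δ
  · exact hs2 t ⟨by simpa using hR, ht⟩
  · push Not at hR
    have htpos : 0 < ‖t‖ := lt_trans (by positivity) hR
    have ht0 : t ≠ 0 := norm_pos_iff.mp htpos
    have h3 : pb t⁻¹ := by
      apply hball
      rw [dist_zero_right, norm_inv, inv_lt_comm₀ htpos hδ]
      refine lt_trans ?_ hR
      rw [inv_eq_one_div]
      gcongr
      norm_num
    have h4 := hab hs1 h3
    have h5 : t • A + M s = t • (A + t⁻¹ • M s) := by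
      rw [smul_add, smul_inv_smul₀ ht0]
    rw [h5, eSig_smul]
    exact mul_ne_zero (pow_ne_zero _ ht0) h4

/-- Open cone. -/
def InCone {n : ℕ} (m : ℕ) (A : Matrix (Fin n) (Fin n) ℂ) : Prop :=
  A.IsHermitian ∧ ∀ j, 1 ≤ j → j ≤ m → 0 < sigmaMinor j A

theorem eSig_ofReal {n : ℕ} (m : ℕ) (M : Matrix (Fin n) (Fin n) ℂ) (hM : M.IsHermitian) :
    eSig m M = (sigmaMinor m M : ℂ) := by
  apply Complex.ext
  · simp [eSig_re]
  · simp [eSig_im m M hM]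

theorem sigmaMinor_zero {n : ℕ} (M : Matrix (Fin n) (Fin n) ℂ) : sigmaMinor 0 M = 1 := by
  simp [sigmaMinor]

theorem sigmaMinor_shift {n m : ℕ} (hm : m ≤ n) (M : Matrix (Fin n) (Fin n) ℂ)
    (hM : M.IsHermitian) (w : ℝ) :
    eSig m ((w : ℂ) • (1 : Matrix (Fin n) (Fin n) ℂ) + M) =
      ((∑ i ∈ Finset.range (m + 1),
        ((i + (n - m)).choose (n - m) : ℝ) * sigmaMinor (m - i) M * w ^ i : ℝ) : ℂ) := by
  rw [eSig_shift_expand hm]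
  push_cast
  refine Finset.sum_congr rfl fun i _ => ?_
  rw [eSig_ofReal _ M hM]

theorem InCone.pos {n m : ℕ} {A : Matrix (Fin n) (Fin n) ℂ} (hA : InCone m A) (j : ℕ) (hj : j ≤ m) :
    0 < sigmaMinor j A := by
  rcases Nat.eq_zero_or_pos j with rfl | h
  · rw [sigmaMinor_zero]; norm_num
  · exact hA.2 j h hj

theorem InCone.ne_zero {n m : ℕ} {A : Matrix (Fin n) (Fin n) ℂ} (hA : InCone m A) :
    eSig m A ≠ 0 := by
  rw [eSig_ofReal _ _ hA.1]
  exact_mod_cast (hA.pos m le_rfl).ne'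

theorem isHermitian_real_smul {n : ℕ} {A : Matrix (Fin n) (Fin n) ℂ} (hA : A.IsHermitian) (r : ℝ) :
    ((r : ℂ) • A).IsHermitian := by
  unfold Matrix.IsHermitian
  rw [Matrix.conjTranspose_smul, hA.eq]
  simp

theorem garding_base {n m : ℕ} (hm : m ≤ n) {A : Matrix (Fin n) (Fin n) ℂ} (hA : InCone m A)
    (t : ℂ) (ht : 0 ≤ t.im) :
    eSig m (t • A + Complex.I • (1 : Matrix (Fin n) (Fin n) ℂ)) ≠ 0 := by
  by_cases ht0 : t = 0
  · rw [ht0, zero_smul, zero_add]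
    have := eSig_shift_ne_zero hm (0 : Matrix (Fin n) (Fin n) ℂ) (by simp) Complex.I (by simp)
    simpa using this
  have h5 : t • A + Complex.I • (1 : Matrix (Fin n) (Fin n) ℂ) =
      t • ((t⁻¹ * Complex.I) • (1 : Matrix (Fin n) (Fin n) ℂ) + A) := by
    rw [smul_add, smul_smul, ← mul_assoc, mul_inv_cancel₀ ht0, one_mul, add_comm]
  rw [h5, eSig_smul]
  refine mul_ne_zero (pow_ne_zero _ ht0) ?_
  set w := t⁻¹ * Complex.I with hw
  by_cases hwi : w.im = 0
  · have hwr : w = (w.re : ℂ) := by apply Complex.ext <;> simp [hwi]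
    have hnn : 0 ≤ w.re := by
      simp only [hw, Complex.mul_re, Complex.inv_re, Complex.inv_im, Complex.I_re, Complex.I_im]
      have : 0 ≤ t.im / Complex.normSq t := div_nonneg ht (Complex.normSq_nonneg _)
      simp only [mul_zero, mul_one, zero_sub, neg_div, neg_neg]
      exact this
    rw [hwr, sigmaMinor_shift hm _ hA.1]
    have : 0 < ∑ i ∈ Finset.range (m + 1),
        ((i + (n - m)).choose (n - m) : ℝ) * sigmaMinor (m - i) A * w.re ^ i := by
      refine Finset.sum_pos' (fun i hi => ?_) ⟨0, by simp, ?_⟩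
      · have := hA.pos (m - i) (by omega)
        positivity
      · have := hA.pos m le_rfl
        simpa using this
    exact_mod_cast this.ne'
  · exact eSig_shift_ne_zero hm A hA.1 w hwi

theorem garding_one {n m : ℕ} (hm : m ≤ n) {A X : Matrix (Fin n) (Fin n) ℂ} (hA : InCone m A)
    (hX : X.IsHermitian) (t : ℂ) (ht : 0 ≤ t.im) :
    eSig m (t • A + (Complex.I • (1 : Matrix (Fin n) (Fin n) ℂ) + X)) ≠ 0 := by
  have := homotopy_roots m A hA.ne_zero
    (fun s => Complex.I • (1 : Matrix (Fin n) (Fin n) ℂ) + (s : ℂ) • X)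
    (continuous_const.add (Complex.continuous_ofReal.smul continuous_const)) ?_ ?_ t ht
  · simpa using this
  · intro s _ t
    have := eSig_shift_ne_zero hm ((t : ℂ) • A + (s : ℂ) • X)
      ((isHermitian_real_smul hA.1 t).add (isHermitian_real_smul hX s)) Complex.I (by simp)
    rwa [add_left_comm] at this
  · intro t ht
    simpa using garding_base hm hA t ht

theorem garding_two {n m : ℕ} (hm : m ≤ n) {A B : Matrix (Fin n) (Fin n) ℂ} (hA : InCone m A)
    (hB : InCone m B) (t w : ℂ) (ht : 0 ≤ t.im) (hw : 0 ≤ w.im) :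
    eSig m (w • B + (Complex.I • (1 : Matrix (Fin n) (Fin n) ℂ) + t • A)) ≠ 0 := by
  have := homotopy_roots m B hB.ne_zero
    (fun s => Complex.I • (1 : Matrix (Fin n) (Fin n) ℂ) +
      ((t.re : ℂ) + (s : ℂ) * ((t.im : ℂ) * Complex.I)) • A)
    (continuous_const.add ((continuous_const.add
      (Complex.continuous_ofReal.mul continuous_const)).smul continuous_const)) ?_ ?_ w hw
  · simpa using this
  · intro s hs w
    have := garding_one hm hA (isHermitian_real_smul hB.1 w)
      ((t.re : ℂ) + (s : ℂ) * ((t.im : ℂ) * Complex.I)) (by simpa using mul_nonneg hs.1 ht)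
    convert this using 2
    abel
  · intro w hw
    have := garding_one hm hB (isHermitian_real_smul hA.1 t.re) w hw
    simpa using this

theorem garding_three {n m : ℕ} (hm : m ≤ n) {A B : Matrix (Fin n) (Fin n) ℂ} (hA : InCone m A)
    (hB : InCone m B) (t w : ℂ) (ht : 0 ≤ t.im) (hw : 0 < w.im) :
    eSig m (w • B + t • A) ≠ 0 := by
  have key : ∀ ε : ℝ, 0 < ε → ‖eSig m B‖ * w.im ^ m ≤
      ‖eSig m (w • B + ((ε : ℂ) • (Complex.I • (1 : Matrix (Fin n) (Fin n) ℂ)) + t • A))‖ := by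
    intro ε hε
    refine eSig_lower_bound m B _ hB.ne_zero (fun w hw => ?_) w hw.le
    have hε0 : (ε : ℂ) ≠ 0 := by exact_mod_cast hε.ne'
    have h5 : w • B + ((ε : ℂ) • (Complex.I • (1 : Matrix (Fin n) (Fin n) ℂ)) + t • A) =
        (ε : ℂ) • ((((ε⁻¹ : ℝ) : ℂ) * w) • B + ((Complex.I • (1 : Matrix (Fin n) (Fin n) ℂ)) +
          (((ε⁻¹ : ℝ) : ℂ) * t) • A)) := by
      push_cast
      rw [smul_add, smul_add, smul_smul (ε : ℂ) ((ε : ℂ)⁻¹ * w), smul_smul (ε : ℂ) ((ε : ℂ)⁻¹ * t),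
        ← mul_assoc, ← mul_assoc, mul_inv_cancel₀ hε0, one_mul, one_mul]
    rw [h5, eSig_smul]
    refine mul_ne_zero (pow_ne_zero _ hε0) (garding_two hm hA hB _ _ ?_ ?_)
    · rw [Complex.im_ofReal_mul]
      positivity
    · rw [Complex.im_ofReal_mul]
      positivity
  have hlim : Filter.Tendsto (fun ε : ℝ =>
      ‖eSig m (w • B + ((ε : ℂ) • (Complex.I • (1 : Matrix (Fin n) (Fin n) ℂ)) + t • A))‖)
      (nhdsWithin 0 (Set.Ioi 0)) (nhds ‖eSig m (w • B + t • A)‖) := by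
    have hc : Continuous (fun ε : ℝ =>
      ‖eSig m (w • B + ((ε : ℂ) • (Complex.I • (1 : Matrix (Fin n) (Fin n) ℂ)) + t • A))‖) :=
      ((continuous_eSig m).comp (continuous_const.add
        ((Complex.continuous_ofReal.smul continuous_const).add continuous_const))).norm
    have := hc.tendsto 0
    simp only [Complex.ofReal_zero, zero_smul, zero_add] at this
    exact this.mono_left nhdsWithin_le_nhds
  have hle := ge_of_tendsto hlim (Filter.eventually_of_mem self_mem_nhdsWithin (fun ε hε => key ε hε))
  have hpos : 0 < ‖eSig m B‖ * w.im ^ m := mul_pos (norm_pos_iff.mpr hB.ne_zero) (by positivity)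
  exact norm_pos_iff.mp (lt_of_lt_of_le hpos hle)

theorem garding_roots {n m : ℕ} (hm : m ≤ n) {A B : Matrix (Fin n) (Fin n) ℂ} (hA : InCone m A)
    (hB : InCone m B) (t : ℂ) (ht : eSig m (t • A + B) = 0) : t.im = 0 ∧ t.re < 0 := by
  have key : ∀ c : ℂ, 0 < c.im → ¬ 0 ≤ (c * t).im := by
    intro c hc hct
    refine garding_three hm hA hB (c * t) c hct hc ?_
    have : c • B + (c * t) • A = c • (t • A + B) := by
      rw [smul_add, smul_smul, add_comm]
    rw [this, eSig_smul, ht, mul_zero]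
  have him : t.im = 0 := by
    by_contra hne
    apply key ⟨(1 - t.re) / t.im, 1⟩ (by simp)
    simp only [Complex.mul_im]
    rw [div_mul_cancel₀ _ hne]
    linarith
  refine ⟨him, ?_⟩
  by_contra hre
  push Not at hre
  apply key Complex.I (by simp)
  simpa using hre

theorem garding_factor {n m : ℕ} (hm : m ≤ n) {A B : Matrix (Fin n) (Fin n) ℂ} (hA : InCone m A)
    (hB : InCone m B) : ∃ r : Fin m → ℝ, (∀ i, 0 < r i) ∧ ∃ Q : Polynomial ℂ,
      Q = Polynomial.C (sigmaMinor m A : ℂ) * ∏ i, (Polynomial.X + Polynomial.C (r i : ℂ)) ∧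
      Q.natDegree ≤ m ∧ ∀ t, Q.eval t = eSig m (t • A + B) := by
  obtain ⟨Q, h1, h2, -, h4⟩ := eSig_pol m A B
  have hc : Q.coeff m ≠ 0 := by rw [h2]; exact hA.ne_zero
  have hdm : Q.natDegree = m := le_antisymm h1 (Polynomial.le_natDegree_of_ne_zero hc)
  have hs : Q.Splits := IsAlgClosed.splits Q
  obtain ⟨l, hl⟩ : ∃ l, l = Q.roots.toList := ⟨_, rfl⟩
  have hcard : l.length = m := by
    rw [hl, Multiset.length_toList, ← hdm]; exact (Polynomial.splits_iff_card_roots.mp hs)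
  have hroot : ∀ z ∈ l, z.im = 0 ∧ z.re < 0 := by
    intro z hz
    rw [hl, Multiset.mem_toList] at hz
    apply garding_roots hm hA hB z
    rw [← h4]
    exact Polynomial.isRoot_of_mem_roots hz
  refine ⟨fun i => -(l[i.1]'(hcard.symm ▸ i.2)).re, fun i => ?_, Q, ?_, h1, h4⟩
  · have := (hroot _ (List.getElem_mem (show i.1 < l.length by omega))).2
    linarith
  · have h5 := hs.eq_prod_roots
    rw [Polynomial.leadingCoeff, hdm, h2, eSig_ofReal m A hA.1] at h5
    conv_lhs => rw [h5]
    congr 1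
    rw [← Multiset.coe_toList Q.roots, ← hl, Multiset.map_coe, Multiset.prod_coe]
    clear h5
    subst hcard
    rw [← Fin.prod_univ_fun_getElem]
    refine Finset.prod_congr rfl fun i _ => ?_
    have h6 := (hroot _ (List.getElem_mem i.2)).1
    have : ((-(l[i.1]).re : ℝ) : ℂ) = - l[i.1] := by
      apply Complex.ext <;> simp [h6]
    rw [this, Polynomial.C_neg, ← sub_eq_add_neg]


theorem count_mem {ι : Type*} [Fintype ι] [DecidableEq ι] (i : ι) (j : ℕ) :
    (((Finset.powersetCard (j+1) (Finset.univ : Finset ι)).filter (fun S => i ∈ S)).card)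
      = (Fintype.card ι - 1).choose j := by
  have h : (Finset.univ : Finset ι) = insert i (Finset.univ.erase i) := by simp
  rw [h, Finset.powersetCard_succ_insert (by simp), Finset.filter_union, Finset.filter_false_of_mem,
    Finset.filter_true_of_mem, Finset.empty_union, Finset.card_image_of_injOn, Finset.card_powersetCard,
    Finset.card_erase_of_mem (by simp), Finset.card_univ]
  · intro S hS T hT hST
    have h1 : i ∉ S := fun hi => by
      have := (Finset.mem_powersetCard.mp hS).1 hi; simp at this
    have h2 : i ∉ T := fun hi => by
      have := (Finset.mem_powersetCard.mp hT).1 hi; simp at this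
    rw [← Finset.erase_insert h1, hST, Finset.erase_insert h2]
  · intro S hS
    obtain ⟨T, _, rfl⟩ := Finset.mem_image.mp hS
    simp
  · intro S hS hi
    have := (Finset.mem_powersetCard.mp hS).1 hi; simp at this

theorem maclaurin {m : ℕ} (hm : 1 ≤ m) (r : Fin m → ℝ) (hr : ∀ i, 0 < r i) (j : ℕ) (hj : j ≤ m) :
    (m.choose j : ℝ) * (∏ i, r i) ^ ((j : ℝ) / m) ≤
      ∑ S ∈ Finset.powersetCard j (Finset.univ : Finset (Fin m)), ∏ i ∈ S, r i := by
  rcases j with _ | j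
  · simp
  set P := Finset.powersetCard (j+1) (Finset.univ : Finset (Fin m)) with hP
  have hcard : P.card = m.choose (j+1) := by rw [hP, Finset.card_powersetCard]; simp
  have hN : (0 : ℝ) < (m.choose (j+1) : ℝ) := by exact_mod_cast Nat.choose_pos hj
  set N : ℝ := (m.choose (j+1) : ℝ) with hNdef
  have hmr : (0 : ℝ) < m := by exact_mod_cast hm
  have h := Real.geom_mean_le_arith_mean_weighted P (fun _ => N⁻¹) (fun S => ∏ i ∈ S, r i)
    (fun _ _ => by positivity) (by
      rw [Finset.sum_const, hcard, nsmul_eq_mul]; exact mul_inv_cancel₀ hN.ne')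
    (fun S _ => Finset.prod_nonneg fun i _ => (hr i).le)
  rw [← Finset.mul_sum, inv_mul_eq_div, le_div_iff₀ hN, mul_comm] at h
  refine le_trans (le_of_eq ?_) h
  congr 1
  rw [Real.finsetProd_rpow _ _ (fun S _ => Finset.prod_nonneg fun i _ => (hr i).le)]
  have h2 : ∏ S ∈ P, ∏ i ∈ S, r i = (∏ i, r i) ^ ((m - 1).choose j) := by
    rw [Finset.prod_comm' (s' := fun i => P.filter (fun S => i ∈ S)) (t' := Finset.univ)]
    · rw [← Finset.prod_pow]
      refine Finset.prod_congr rfl fun i _ => ?_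
      rw [Finset.prod_const, hP, count_mem, Fintype.card_fin]
    · intro S i; simp
  rw [h2, ← Real.rpow_natCast, ← Real.rpow_mul (Finset.prod_nonneg fun i _ => (hr i).le)]
  congr 1
  rw [← div_eq_mul_inv, div_eq_div_iff hmr.ne' hN.ne', hNdef]
  obtain ⟨m, rfl⟩ : ∃ m', m = m' + 1 := ⟨m - 1, by omega⟩
  have := Nat.add_one_mul_choose_eq m j
  have h' : ((m + 1 : ℕ) : ℝ) * (m.choose j : ℝ) = ((m+1).choose (j+1) : ℝ) * ((j + 1 : ℕ) : ℝ) := by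
    exact_mod_cast this
  simp only [Nat.add_sub_cancel]
  linarith

theorem alt_sum_card (k j : ℕ) {α : Type*} (K : Finset α) (hK : K.card = k) (hj : j ≤ k) :
    ∑ T ∈ K.powerset, (-1 : ℝ) ^ (k - T.card) * (T.card : ℝ) ^ j =
      if j = k then (k.factorial : ℝ) else 0 := by
  rw [Finset.sum_powerset_apply_card (fun a => (-1 : ℝ) ^ (k - a) * (a : ℝ) ^ j), hK]
  have h := fwdDiff_iter_eq_sum_shift (1 : ℝ) (fun x : ℝ => x ^ j) k 0
  have h2 : ∑ a ∈ Finset.range (k + 1), k.choose a • ((-1 : ℝ) ^ (k - a) * (a : ℝ) ^ j) =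
      (fwdDiff (1 : ℝ))^[k] (fun x : ℝ => x ^ j) 0 := by
    rw [h]
    refine Finset.sum_congr rfl fun a _ => ?_
    simp
    ring
  rw [h2]
  split_ifs with hjk
  · subst hjk
    rw [fwdDiff_iter_eq_factorial]; simp
  · rw [fwdDiff_iter_pow_eq_zero_of_lt (by omega)]; simp

theorem sum_powerset_split {α : Type*} [Fintype α] [DecidableEq α] (K : Finset α)
    (F G : ℕ → ℝ) :
    ∑ T : Finset α, F (T ∩ K).card * G (T ∩ Kᶜ).card =
      (∑ T ∈ K.powerset, F T.card) * (∑ T ∈ Kᶜ.powerset, G T.card) := by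
  rw [Finset.sum_mul_sum, ← Finset.sum_product']
  refine Finset.sum_bij' (fun T _ => (T ∩ K, T ∩ Kᶜ)) (fun p _ => p.1 ∪ p.2) ?_ ?_ ?_ ?_ ?_
  · intro T _; simp
  · intro p _; simp
  · intro T _
    ext x; simp only [Finset.mem_union, Finset.mem_inter, Finset.mem_compl]; tauto
  · rintro ⟨S, T⟩ h
    simp only [Finset.mem_product, Finset.mem_powerset] at h
    have h1 : ∀ x, x ∈ S → x ∈ K := fun x hx => h.1 hx
    have h2 : ∀ x, x ∈ T → x ∉ K := fun x hx => by simpa using h.2 hx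
    apply Prod.ext
    · ext x
      simp only [Finset.mem_union, Finset.mem_inter]
      have := h1 x; have := h2 x; tauto
    · ext x
      simp only [Finset.mem_union, Finset.mem_inter, Finset.mem_compl]
      have := h1 x; have := h2 x; tauto
  · intro T _; rfl

theorem sigmaMinor_comb {n m : ℕ} (A B : Matrix (Fin n) (Fin n) ℂ) (Q : Polynomial ℂ)
    (hd : Q.natDegree ≤ m) (hQ : ∀ t, Q.eval t = eSig m (t • A + B)) (hA : Q.coeff m = eSig m A)
    (a b : ℕ) :
    sigmaMinor m (a • A + b • B) =
      ∑ j ∈ Finset.range (m + 1), (Q.coeff j).re * ((a : ℝ) ^ j * (b : ℝ) ^ (m - j)) := by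
  have key : eSig m ((a : ℂ) • A + (b : ℂ) • B) =
      ∑ j ∈ Finset.range (m + 1), Q.coeff j * (((a : ℝ) ^ j * (b : ℝ) ^ (m - j) : ℝ) : ℂ) := by
    push_cast
    by_cases hb : (b : ℂ) = 0
    · rw [hb, zero_smul, add_zero, eSig_smul, Finset.sum_range_succ, Finset.sum_eq_zero]
      · simp [hA, mul_comm]
      · intro j hj
        rw [zero_pow (by have := Finset.mem_range.mp hj; omega)]
        simp
    · have : (a : ℂ) • A + (b : ℂ) • B = (b : ℂ) • (((a : ℂ) / b) • A + B) := by
        rw [smul_add, smul_smul, mul_div_cancel₀ _ hb]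
      rw [this, eSig_smul, ← hQ, Polynomial.eval_eq_sum_range' (Nat.lt_succ_of_le hd), Finset.mul_sum]
      refine Finset.sum_congr rfl fun j hj => ?_
      have hj' : j ≤ m := by have := Finset.mem_range.mp hj; omega
      have hbm : (b : ℂ) ^ m = (b : ℂ) ^ j * (b : ℂ) ^ (m - j) := by
        rw [← pow_add]; congr 1; omega
      rw [hbm, div_pow]
      field_simp
  have h2 : a • A + b • B = (a : ℂ) • A + (b : ℂ) • B := by
    rw [Nat.cast_smul_eq_nsmul, Nat.cast_smul_eq_nsmul]
  rw [h2, ← eSig_re, key, Complex.re_sum]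
  refine Finset.sum_congr rfl fun j _ => ?_
  rw [Complex.re_mul_ofReal]

theorem Dpol_eq {n m : ℕ} (hm : 1 ≤ m) (A B : Matrix (Fin n) (Fin n) ℂ) (Q : Polynomial ℂ)
    (hd : Q.natDegree ≤ m) (hQ : ∀ t, Q.eval t = eSig m (t • A + B)) (hA : Q.coeff m = eSig m A)
    (k : ℕ) (hk : k ≤ m) :
    (m.choose k : ℝ) * Dpol (fun j : Fin m => if (j : ℕ) < k then A else B) = (Q.coeff k).re := by
  set K : Finset (Fin m) := Finset.univ.filter (fun j : Fin m => (j : ℕ) < k) with hK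
  have hKc : K.card = k := by rw [hK, Fin.card_filter_val_lt]; omega
  have hKcc : Kᶜ.card = m - k := by rw [Finset.card_compl, hKc, Fintype.card_fin]
  have hsum : ∀ T : Finset (Fin m), (∑ j ∈ T, (if (j : ℕ) < k then A else B)) =
      (T ∩ K).card • A + (T ∩ Kᶜ).card • B := by
    intro T
    rw [Finset.sum_ite, Finset.sum_const, Finset.sum_const]
    congr 3
    · ext x; simp [hK]
    · ext x; simp [hK]
  have hS : ∑ T ∈ (Finset.univ : Finset (Finset (Fin m))).filter (fun T => T ≠ ∅),
      (-1 : ℝ) ^ (m - T.card) * sigmaMinor m (∑ j ∈ T, (if (j : ℕ) < k then A else B)) =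
      (Q.coeff k).re * ((k.factorial : ℝ) * ((m - k).factorial : ℝ)) := by
    rw [Finset.sum_filter_of_ne]
    · have h1 : ∀ T : Finset (Fin m),
        (-1 : ℝ) ^ (m - T.card) * sigmaMinor m (∑ j ∈ T, (if (j : ℕ) < k then A else B)) =
        ∑ j ∈ Finset.range (m + 1), (Q.coeff j).re *
          (((-1 : ℝ) ^ (k - (T ∩ K).card) * ((T ∩ K).card : ℝ) ^ j) *
           ((-1 : ℝ) ^ ((m - k) - (T ∩ Kᶜ).card) * ((T ∩ Kᶜ).card : ℝ) ^ (m - j))) := by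
        intro T
        rw [hsum, sigmaMinor_comb A B Q hd hQ hA, Finset.mul_sum]
        refine Finset.sum_congr rfl fun j _ => ?_
        have hc : T.card = (T ∩ K).card + (T ∩ Kᶜ).card := by
          rw [← Finset.sdiff_eq_inter_compl, Finset.card_inter_add_card_sdiff]
        have hc1 : (T ∩ K).card ≤ k := hKc ▸ Finset.card_le_card Finset.inter_subset_right
        have hc2 : (T ∩ Kᶜ).card ≤ m - k := hKcc ▸ Finset.card_le_card Finset.inter_subset_right
        have : m - T.card = (k - (T ∩ K).card) + ((m - k) - (T ∩ Kᶜ).card) := by omega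
        rw [this, pow_add]
        ring
      rw [Finset.sum_congr rfl fun T _ => h1 T, Finset.sum_comm]
      have h2 : ∀ j ∈ Finset.range (m + 1), ∑ T : Finset (Fin m), (Q.coeff j).re *
          (((-1 : ℝ) ^ (k - (T ∩ K).card) * ((T ∩ K).card : ℝ) ^ j) *
           ((-1 : ℝ) ^ ((m - k) - (T ∩ Kᶜ).card) * ((T ∩ Kᶜ).card : ℝ) ^ (m - j))) =
          if j = k then (Q.coeff k).re * ((k.factorial : ℝ) * ((m - k).factorial : ℝ)) else 0 := by
        intro j hj
        have hj' : j ≤ m := by have := Finset.mem_range.mp hj; omega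
        rw [← Finset.mul_sum, sum_powerset_split K (fun a => (-1 : ℝ) ^ (k - a) * (a : ℝ) ^ j)
          (fun b => (-1 : ℝ) ^ ((m - k) - b) * (b : ℝ) ^ (m - j))]
        rcases lt_trichotomy j k with h | h | h
        · rw [alt_sum_card k j K hKc h.le, if_neg h.ne, if_neg h.ne]; simp
        · subst h
          rw [alt_sum_card j j K hKc le_rfl, alt_sum_card (m - j) (m - j) _ hKcc le_rfl]
          simp
        · rw [alt_sum_card (m - k) (m - j) _ hKcc (by omega), if_neg (by omega), if_neg h.ne']; simp
      rw [Finset.sum_congr rfl h2, Finset.sum_ite_eq' _ k, if_pos (by simp; omega)]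
    · intro T _ hT h0
      apply hT
      subst h0
      have : eSig m (0 : Matrix (Fin n) (Fin n) ℂ) = 0 := by
        have := eSig_smul m 0 (0 : Matrix (Fin n) (Fin n) ℂ)
        rw [zero_smul, zero_pow (by omega), zero_mul] at this
        exact this
      rw [Finset.sum_empty, ← eSig_re, this]
      simp
  rw [Dpol, hS]
  have h3 : (m.choose k : ℝ) * ((k.factorial : ℝ) * ((m - k).factorial : ℝ)) = m.factorial := by
    rw [← mul_assoc]; exact_mod_cast Nat.choose_mul_factorial_mul_factorial hk
  have h4 : (m.factorial : ℝ) ≠ 0 := by exact_mod_cast Nat.factorial_ne_zero m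
  calc _ = (m.factorial : ℝ)⁻¹ * ((m.choose k : ℝ) * ((k.factorial : ℝ) * ((m - k).factorial : ℝ))) * (Q.coeff k).re := by ring
    _ = _ := by rw [h3, inv_mul_cancel₀ h4, one_mul]

theorem mixed_open {n m : ℕ} (hm : 1 ≤ m) (hmn : m ≤ n) {A B : Matrix (Fin n) (Fin n) ℂ}
    (hA : InCone m A) (hB : InCone m B) (k : ℕ) (hk : k ≤ m) :
    sigmaMinor m A ^ ((k : ℝ) / m) * sigmaMinor m B ^ (((m - k : ℕ) : ℝ) / m) ≤
      Dpol (fun j : Fin m => if (j : ℕ) < k then A else B) := by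
  obtain ⟨r, hr, Q, hQ, hd, hev⟩ := garding_factor hmn hA hB
  have hcoef : ∀ j ≤ m, Q.coeff j = ((sigmaMinor m A *
      ∑ S ∈ Finset.powersetCard (m - j) (Finset.univ : Finset (Fin m)), ∏ i ∈ S, r i : ℝ) : ℂ) := by
    intro j hj
    rw [hQ, Polynomial.coeff_C_mul, Finset.prod_X_add_C_coeff _ _ (by simpa using hj)]
    simp
  have hAm : Q.coeff m = eSig m A := by
    rw [hcoef m le_rfl, eSig_ofReal m A hA.1]; simp
  have hB0 : sigmaMinor m B = sigmaMinor m A * ∏ i, r i := by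
    have h1 := hev 0
    rw [zero_smul, zero_add, ← Polynomial.coeff_zero_eq_eval_zero, hcoef 0 (by omega),
      eSig_ofReal m B hB.1] at h1
    have h2 := Complex.ofReal_injective h1
    rw [← h2]
    congr 1
    have : Finset.powersetCard (m - 0) (Finset.univ : Finset (Fin m)) = {Finset.univ} := by
      have := Finset.powersetCard_self (Finset.univ : Finset (Fin m))
      simpa using this
    rw [this, Finset.sum_singleton]
  have hD := Dpol_eq hm A B Q hd hev hAm k hk
  rw [hcoef k hk, Complex.ofReal_re] at hD
  have hM := maclaurin hm r hr (m - k) (by omega)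
  have hpA := hA.pos m le_rfl
  have hR : 0 < ∏ i, r i := Finset.prod_pos fun i _ => hr i
  have hmr : (0 : ℝ) < m := by exact_mod_cast hm
  have hC : (0 : ℝ) < (m.choose k : ℝ) := by exact_mod_cast Nat.choose_pos hk
  rw [Nat.choose_symm hk] at hM
  have h1 : sigmaMinor m A ^ ((k : ℝ) / m) * sigmaMinor m B ^ (((m - k : ℕ) : ℝ) / m) =
      sigmaMinor m A * (∏ i, r i) ^ (((m - k : ℕ) : ℝ) / m) := by
    rw [hB0, Real.mul_rpow hpA.le hR.le, ← mul_assoc, ← Real.rpow_add hpA]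
    have : (k : ℝ) / m + ((m - k : ℕ) : ℝ) / m = 1 := by
      rw [Nat.cast_sub hk]; field_simp; ring
    rw [this, Real.rpow_one]
  rw [h1]
  refine le_of_mul_le_mul_left ?_ hC
  rw [hD]
  calc _ = sigmaMinor m A * ((m.choose k : ℝ) * (∏ i, r i) ^ (((m - k : ℕ) : ℝ) / m)) := by ring
    _ ≤ _ := mul_le_mul_of_nonneg_left hM hpA.le

theorem inCone_shift {n m : ℕ} (hmn : m ≤ n) {A : Matrix (Fin n) (Fin n) ℂ} (hA : A.IsHermitian)
    (h : ∀ j, 1 ≤ j → j ≤ m → 0 ≤ sigmaMinor j A) (ε : ℝ) (hε : 0 < ε) :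
    InCone m ((ε : ℂ) • (1 : Matrix (Fin n) (Fin n) ℂ) + A) := by
  refine ⟨(isHermitian_real_smul Matrix.isHermitian_one ε).add hA, fun j _ hj => ?_⟩
  rw [← eSig_re, sigmaMinor_shift (hj.trans hmn) A hA, Complex.ofReal_re]
  refine Finset.sum_pos' (fun i hi => ?_) ⟨j, by simp, ?_⟩
  · have : 0 ≤ sigmaMinor (j - i) A := by
      rcases Nat.eq_zero_or_pos (j - i) with h0 | h0
      · rw [h0, sigmaMinor_zero]; norm_num
      · exact h _ h0 (by omega)
    positivity
  · rw [Nat.sub_self, sigmaMinor_zero]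
    have : 0 < (j + (n - j)).choose (n - j) := Nat.choose_pos (by omega)
    positivity

theorem continuous_sigmaMinor {n : ℕ} (m : ℕ) :
    Continuous (fun M : Matrix (Fin n) (Fin n) ℂ => sigmaMinor m M) :=
  Complex.continuous_re.comp (continuous_eSig m)

theorem mixed_closed {n m : ℕ} (hm : 1 ≤ m) (hmn : m ≤ n) {A B : Matrix (Fin n) (Fin n) ℂ}
    (hA : A.IsHermitian) (hB : B.IsHermitian)
    (hA' : ∀ j, 1 ≤ j → j ≤ m → 0 ≤ sigmaMinor j A)
    (hB' : ∀ j, 1 ≤ j → j ≤ m → 0 ≤ sigmaMinor j B) (k : ℕ) (hk : k ≤ m) :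
    sigmaMinor m A ^ ((k : ℝ) / m) * sigmaMinor m B ^ (((m - k : ℕ) : ℝ) / m) ≤
      Dpol (fun j : Fin m => if (j : ℕ) < k then A else B) := by
  set S : Matrix (Fin n) (Fin n) ℂ → ℝ → Matrix (Fin n) (Fin n) ℂ :=
    fun M ε => (ε : ℂ) • (1 : Matrix (Fin n) (Fin n) ℂ) + M with hS
  have hSc : ∀ M, Continuous (S M) := fun M =>
    (Complex.continuous_ofReal.smul continuous_const).add continuous_const
  have hS0 : ∀ M, S M 0 = M := fun M => by simp [hS]
  have hc1 : Continuous (fun ε : ℝ => sigmaMinor m (S A ε) ^ ((k : ℝ) / m) *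
      sigmaMinor m (S B ε) ^ (((m - k : ℕ) : ℝ) / m)) :=
    (((continuous_sigmaMinor m).comp (hSc A)).rpow_const (fun _ => Or.inr (by positivity))).mul
      (((continuous_sigmaMinor m).comp (hSc B)).rpow_const (fun _ => Or.inr (by positivity)))
  have hc2 : Continuous (fun ε : ℝ =>
      Dpol (fun j : Fin m => if (j : ℕ) < k then S A ε else S B ε)) := by
    unfold Dpol
    refine continuous_const.mul (continuous_finsetSum _ fun T _ => continuous_const.mul ?_)
    refine (continuous_sigmaMinor m).comp (continuous_finsetSum _ fun j _ => ?_)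
    beta_reduce
    split_ifs
    · exact hSc A
    · exact hSc B
  have h1 := (hc1.tendsto 0).mono_left (nhdsWithin_le_nhds (s := Set.Ioi (0 : ℝ)))
  have h2 := (hc2.tendsto 0).mono_left (nhdsWithin_le_nhds (s := Set.Ioi (0 : ℝ)))
  have h3 := le_of_tendsto_of_tendsto h1 h2 (Filter.eventually_of_mem self_mem_nhdsWithin
    (fun ε hε => mixed_open hm hmn (inCone_shift hmn hA hA' ε hε) (inCone_shift hmn hB hB' ε hε) k hk))
  simpa only [hS0] using h3

theorem complexHessian_isHermitian {n : ℕ} (u : (Fin n → ℂ) → ℝ) (Ω : Set (Fin n → ℂ))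
    (hΩ : IsOpen Ω) (hu : ContDiffOn ℝ 2 u Ω) (z : Fin n → ℂ) (hz : z ∈ Ω) :
    (complexHessian u Ω z).IsHermitian := by
  have hsym : IsSymmSndFDerivWithinAt ℝ u Ω z :=
    (hu z hz).isSymmSndFDerivWithinAt (by simp) hΩ.uniqueDiffOn
      (by rw [hΩ.interior_eq]; exact subset_closure hz) hz
  have hD : ∀ a b, iteratedFDerivWithin ℝ 2 u Ω z ![a, b] = iteratedFDerivWithin ℝ 2 u Ω z ![b, a] :=
    fun a b => IsSymmSndFDerivWithinAt.iteratedFDerivWithin_cons (hf := hsym) hΩ.uniqueDiffOn hz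
  ext j k
  rw [Matrix.conjTranspose_apply]
  simp only [complexHessian]
  rw [hD (Pi.single k 1) (Pi.single j 1), hD (Complex.I • Pi.single k 1) (Complex.I • Pi.single j 1),
    hD (Pi.single k 1) (Complex.I • Pi.single j 1), hD (Complex.I • Pi.single k 1) (Pi.single j 1)]
  apply Complex.ext
  · simp
  · simp
    ring

/-- Smooth two-potential mixed Hessian inequality (Theorem 3.7 of the paper, smooth flat
case): if `u, v` are `C²` on an open `Ω ⊆ ℂⁿ` with `σ_j(H(u)) ≥ 0` and `σ_j(H(v)) ≥ 0`
on `Ω` for all `j = 1,…,m`, and `σ_m(H(u)) ≥ f ≥ 0`, `σ_m(H(v)) ≥ g ≥ 0` on `Ω`, then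
for every `0 ≤ k ≤ m` and `z ∈ Ω`, the polarized form with `k` copies of `H(u)(z)` and
`m−k` copies of `H(v)(z)` is at least `f(z)^{k/m} g(z)^{(m−k)/m}`. -/
theorem smooth_two_potential_mixed_hessian_inequality {n m : ℕ}
    (hn : 1 ≤ n) (hm : 1 ≤ m) (hmn : m ≤ n)
    (Ω : Set (Fin n → ℂ)) (hΩ : IsOpen Ω)
    (u v : (Fin n → ℂ) → ℝ) (hu : ContDiffOn ℝ 2 u Ω) (hv : ContDiffOn ℝ 2 v Ω)
    (f g : (Fin n → ℂ) → ℝ)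
    (hf : ∀ z ∈ Ω, 0 ≤ f z) (hg : ∀ z ∈ Ω, 0 ≤ g z)
    (hmshu : ∀ j, 1 ≤ j → j ≤ m → ∀ z ∈ Ω, 0 ≤ sigmaMinor j (complexHessian u Ω z))
    (hmshv : ∀ j, 1 ≤ j → j ≤ m → ∀ z ∈ Ω, 0 ≤ sigmaMinor j (complexHessian v Ω z))
    (hfm : ∀ z ∈ Ω, f z ≤ sigmaMinor m (complexHessian u Ω z))
    (hgm : ∀ z ∈ Ω, g z ≤ sigmaMinor m (complexHessian v Ω z)) :
    ∀ k ≤ m, ∀ z ∈ Ω,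
      Dpol (fun j : Fin m =>
          if (j : ℕ) < k then complexHessian u Ω z else complexHessian v Ω z)
        ≥ f z ^ ((k : ℝ) / m) * g z ^ (((m - k : ℕ) : ℝ) / m) := by

  intro k hk z hz
  have h := mixed_closed hm hmn (complexHessian_isHermitian u Ω hΩ hu z hz)
    (complexHessian_isHermitian v Ω hΩ hv z hz) (fun j h1 h2 => hmshu j h1 h2 z hz)
    (fun j h1 h2 => hmshv j h1 h2 z hz) k hk
  refine le_trans ?_ h
  have h1 := hf z hz
  have h2 := hg z hz
  exact mul_le_mul (Real.rpow_le_rpow h1 (hfm z hz) (by positivity))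
    (Real.rpow_le_rpow h2 (hgm z hz) (by positivity)) (Real.rpow_nonneg h2 _)
    (Real.rpow_nonneg (h1.trans (hfm z hz)) _)
end
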